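/- Let k>0 and 0<φ₀<π/2. Let W ⊂ ℝ² be a closed sector with vertex O and opening angle 2φ₀ < π, i.e. W = {O + r(cos θ e₁' + sin θ e₂') : r ≥ 0, |θ| ≤ φ₀} for some point O ∈ ℝ² and some orthonormal basis (e₁', e₂') of ℝ². Let q : ℝ² → ℂ be bounded measurable with q = 1 on ℝ² \ W, with q−1 compactly supported, and suppose there exist r>0, α>0, C≥0 such that |q(x)−q(y)| ≤ C|x−y|^α for all x,y ∈ W ∩ B(O,r), and q(O) ≠ 1. Let u, u^in : ℝ² → ℂ be C² functions with Δu^in + k²u^in = 0 and Δu + k²qu = 0 pointwise on ℝ², and suppose u = u^in on ℝ² \ W. Then u^in ≡ 0 on ℝ². -/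

import Mathlib

open MeasureTheory Metric Set Real
open scoped InnerProductSpace

/-- The Euclidean Laplacian of a function `u : ℝ² → ℂ`:
`Δu(x) = ∑ i, ∂²u/∂xᵢ²(x)`. -/
noncomputable def laplacian2 (u : EuclideanSpace ℝ (Fin 2) → ℂ)
    (x : EuclideanSpace ℝ (Fin 2)) : ℂ :=
  ∑ i : Fin 2,
    fderiv ℝ (fun y => fderiv ℝ u y (EuclideanSpace.single i (1 : ℝ))) x
      (EuclideanSpace.single i (1 : ℝ))

namespace CornerAux
open Filter Topology

noncomputable def dX {E : Type*} [NormedAddCommGroup E] [NormedSpace ℝ E] (f : ℂ → E) (z : ℂ) : E :=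
  fderiv ℝ f z 1
noncomputable def dY {E : Type*} [NormedAddCommGroup E] [NormedSpace ℝ E] (f : ℂ → E) (z : ℂ) : E :=
  fderiv ℝ f z Complex.I
noncomputable def lapC {E : Type*} [NormedAddCommGroup E] [NormedSpace ℝ E] (f : ℂ → E) (z : ℂ) : E :=
  dX (dX f) z + dY (dY f) z

section basic
variable {E : Type*} [NormedAddCommGroup E] [NormedSpace ℝ E]

lemma contDiff_dX {f : ℂ → E} (n : ℕ) (hf : ContDiff ℝ (n + 1 : ℕ) f) : ContDiff ℝ n (dX f) := by
  have : ContDiff ℝ n (fderiv ℝ f) := hf.fderiv_right (by norm_cast)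
  exact this.clm_apply contDiff_const

lemma contDiff_dY {f : ℂ → E} (n : ℕ) (hf : ContDiff ℝ (n + 1 : ℕ) f) : ContDiff ℝ n (dY f) := by
  have : ContDiff ℝ n (fderiv ℝ f) := hf.fderiv_right (by norm_cast)
  exact this.clm_apply contDiff_const

lemma fderiv_eq_dXY {f : ℂ → E} (z v : ℂ) : fderiv ℝ f z v = v.re • dX f z + v.im • dY f z := by
  have hv : v = v.re • (1:ℂ) + v.im • Complex.I := by
    apply Complex.ext <;> simp
  conv_lhs => rw [hv]
  simp only [map_add, map_smul, dX, dY]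

lemma dXY_symm {f : ℂ → E} (hf : ContDiff ℝ 2 f) (z : ℂ) : dX (dY f) z = dY (dX f) z := by
  have h1 : DifferentiableAt ℝ (fderiv ℝ f) z :=
    (hf.fderiv_right (m := 1) (by norm_num)).differentiable (by norm_num) z
  have hs : IsSymmSndFDerivAt ℝ f z := hf.contDiffAt.isSymmSndFDerivAt (by simp)
  have e1 : dX (dY f) z = fderiv ℝ (fderiv ℝ f) z 1 Complex.I := by
    unfold dX dY
    rw [fderiv_clm_apply h1 (by fun_prop)]; simp
  have e2 : dY (dX f) z = fderiv ℝ (fderiv ℝ f) z Complex.I 1 := by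
    unfold dX dY
    rw [fderiv_clm_apply h1 (by fun_prop)]; simp
  rw [e1, e2]; exact hs.eq _ _

end basic

lemma dX_mul {A : Type*} [NormedRing A] [NormedAlgebra ℝ A] {f g : ℂ → A} {z : ℂ} (hf : DifferentiableAt ℝ f z)
    (hg : DifferentiableAt ℝ g z) : dX (fun z => f z * g z) z = f z * dX g z + dX f z * g z := by
  unfold dX; rw [fderiv_fun_mul' hf hg]; simp

lemma dY_mul {A : Type*} [NormedRing A] [NormedAlgebra ℝ A] {f g : ℂ → A} {z : ℂ} (hf : DifferentiableAt ℝ f z)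
    (hg : DifferentiableAt ℝ g z) : dY (fun z => f z * g z) z = f z * dY g z + dY f z * g z := by
  unfold dY; rw [fderiv_fun_mul' hf hg]; simp

lemma dX_add {E : Type*} [NormedAddCommGroup E] [NormedSpace ℝ E] {f g : ℂ → E} {z : ℂ} (hf : DifferentiableAt ℝ f z)
    (hg : DifferentiableAt ℝ g z) : dX (fun z => f z + g z) z = dX f z + dX g z := by
  unfold dX; rw [fderiv_fun_add hf hg]; simp

lemma dY_add {E : Type*} [NormedAddCommGroup E] [NormedSpace ℝ E] {f g : ℂ → E} {z : ℂ} (hf : DifferentiableAt ℝ f z)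
    (hg : DifferentiableAt ℝ g z) : dY (fun z => f z + g z) z = dY f z + dY g z := by
  unfold dY; rw [fderiv_fun_add hf hg]; simp

lemma dX_sub {E : Type*} [NormedAddCommGroup E] [NormedSpace ℝ E] {f g : ℂ → E} {z : ℂ} (hf : DifferentiableAt ℝ f z)
    (hg : DifferentiableAt ℝ g z) : dX (fun z => f z - g z) z = dX f z - dX g z := by
  unfold dX; rw [fderiv_fun_sub hf hg]; simp

lemma dY_sub {E : Type*} [NormedAddCommGroup E] [NormedSpace ℝ E] {f g : ℂ → E} {z : ℂ} (hf : DifferentiableAt ℝ f z)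
    (hg : DifferentiableAt ℝ g z) : dY (fun z => f z - g z) z = dY f z - dY g z := by
  unfold dY; rw [fderiv_fun_sub hf hg]; simp

section C2
variable {E : Type*} [NormedAddCommGroup E] [NormedSpace ℝ E] {f : ℂ → E}

lemma C2.d (hf : ContDiff ℝ 2 f) : Differentiable ℝ f := hf.differentiable (by norm_num)
lemma C2.dX1 (hf : ContDiff ℝ 2 f) : ContDiff ℝ 1 (dX f) := contDiff_dX 1 hf
lemma C2.dY1 (hf : ContDiff ℝ 2 f) : ContDiff ℝ 1 (dY f) := contDiff_dY 1 hf
lemma C2.dXd (hf : ContDiff ℝ 2 f) : Differentiable ℝ (dX f) := (C2.dX1 hf).differentiable (by norm_num)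
lemma C2.dYd (hf : ContDiff ℝ 2 f) : Differentiable ℝ (dY f) := (C2.dY1 hf).differentiable (by norm_num)
lemma C1.dXc (hf : ContDiff ℝ 1 f) : Continuous (dX f) := (contDiff_dX 0 hf).continuous
lemma C1.dYc (hf : ContDiff ℝ 1 f) : Continuous (dY f) := (contDiff_dY 0 hf).continuous
lemma C2.lapc (hf : ContDiff ℝ 2 f) : Continuous (lapC f) :=
  (C1.dXc (C2.dX1 hf)).add (C1.dYc (C2.dY1 hf))
end C2

lemma lapC_add {E : Type*} [NormedAddCommGroup E] [NormedSpace ℝ E] {f g : ℂ → E}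
    (hf : ContDiff ℝ 2 f) (hg : ContDiff ℝ 2 g) (z : ℂ) :
    lapC (fun z => f z + g z) z = lapC f z + lapC g z := by
  have e1 : dX (fun z => f z + g z) = fun z => dX f z + dX g z := by
    ext z; exact dX_add (C2.d hf z) (C2.d hg z)
  have e2 : dY (fun z => f z + g z) = fun z => dY f z + dY g z := by
    ext z; exact dY_add (C2.d hf z) (C2.d hg z)
  unfold lapC
  rw [e1, e2, dX_add (C2.dXd hf z) (C2.dXd hg z), dY_add (C2.dYd hf z) (C2.dYd hg z)]
  abel

lemma lapC_sub {E : Type*} [NormedAddCommGroup E] [NormedSpace ℝ E] {f g : ℂ → E}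
    (hf : ContDiff ℝ 2 f) (hg : ContDiff ℝ 2 g) (z : ℂ) :
    lapC (fun z => f z - g z) z = lapC f z - lapC g z := by
  have e1 : dX (fun z => f z - g z) = fun z => dX f z - dX g z := by
    ext z; exact dX_sub (C2.d hf z) (C2.d hg z)
  have e2 : dY (fun z => f z - g z) = fun z => dY f z - dY g z := by
    ext z; exact dY_sub (C2.d hf z) (C2.d hg z)
  unfold lapC
  rw [e1, e2, dX_sub (C2.dXd hf z) (C2.dXd hg z), dY_sub (C2.dYd hf z) (C2.dYd hg z)]
  abel

lemma lapC_mul {A : Type*} [NormedCommRing A] [NormedAlgebra ℝ A] {f g : ℂ → A}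
    (hf : ContDiff ℝ 2 f) (hg : ContDiff ℝ 2 g) (z : ℂ) :
    lapC (fun z => f z * g z) z = lapC f z * g z + 2 * (dX f z * dX g z + dY f z * dY g z)
      + f z * lapC g z := by
  have e1 : dX (fun z => f z * g z) = fun z => f z * dX g z + dX f z * g z := by
    ext z; exact dX_mul (C2.d hf z) (C2.d hg z)
  have e2 : dY (fun z => f z * g z) = fun z => f z * dY g z + dY f z * g z := by
    ext z; exact dY_mul (C2.d hf z) (C2.d hg z)
  unfold lapC
  rw [e1, e2, dX_add ((C2.d hf z).fun_mul (C2.dXd hg z)) ((C2.dXd hf z).fun_mul (C2.d hg z)),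
    dY_add ((C2.d hf z).fun_mul (C2.dYd hg z)) ((C2.dYd hf z).fun_mul (C2.d hg z)),
    dX_mul (C2.d hf z) (C2.dXd hg z), dX_mul (C2.dXd hf z) (C2.d hg z),
    dY_mul (C2.d hf z) (C2.dYd hg z), dY_mul (C2.dYd hf z) (C2.d hg z)]
  ring

end CornerAux

namespace CornerAux
open Filter Topology

section param
variable {H E : Type*} [NormedAddCommGroup H] [NormedSpace ℝ H] [FiniteDimensional ℝ H]
  [NormedAddCommGroup E] [NormedSpace ℝ E] [CompleteSpace E]

lemma param_hasFDerivAt {Φ : H × ℝ → E} (hΦ : ContDiff ℝ 1 Φ) (z : H) :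
    HasFDerivAt (fun z => ∫ t in (0:ℝ)..1, Φ (z, t))
      (∫ t in (0:ℝ)..1, (fderiv ℝ Φ (z, t)).comp (ContinuousLinearMap.inl ℝ H ℝ)) z := by
  have hc : Continuous (fun p : H × ℝ => (fderiv ℝ Φ p).comp (ContinuousLinearMap.inl ℝ H ℝ)) := by
    have := hΦ.continuous_fderiv (by norm_num)
    exact this.clm_comp continuous_const
  have hK : IsCompact (closedBall z 1 ×ˢ Icc (0:ℝ) 1) := by
    have := FiniteDimensional.proper ℝ H
    exact (isCompact_closedBall z 1).prod isCompact_Icc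
  obtain ⟨C, hC⟩ := hK.exists_bound_of_continuousOn hc.continuousOn
  have hd : Differentiable ℝ Φ := hΦ.differentiable (by norm_num)
  apply intervalIntegral.hasFDerivAt_integral_of_dominated_of_fderiv_le
    (F := fun z t => Φ (z, t))
    (F' := fun z t => (fderiv ℝ Φ (z, t)).comp (ContinuousLinearMap.inl ℝ H ℝ))
    (bound := fun _ => C) (closedBall_mem_nhds z one_pos)
  · refine Eventually.of_forall fun x => ?_
    exact (hΦ.continuous.comp (by fun_prop : Continuous fun t : ℝ => (x, t))).aestronglyMeasurable
  · exact (hΦ.continuous.comp (by fun_prop : Continuous fun t : ℝ => (z, t))).intervalIntegrable _ _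
  · exact (hc.comp (by fun_prop : Continuous fun t : ℝ => (z, t))).aestronglyMeasurable
  · refine Eventually.of_forall fun t ht x hx => ?_
    rw [uIoc_of_le zero_le_one] at ht
    exact hC (x, t) ⟨hx, ht.1.le, ht.2⟩
  · simp
  · refine Eventually.of_forall fun t ht x hx => ?_
    have h1 : HasFDerivAt (fun x : H => (x, t)) (ContinuousLinearMap.inl ℝ H ℝ) x :=
      hasFDerivAt_prodMk_left x t
    exact (hd (x, t)).hasFDerivAt.comp x h1

lemma param_contDiff_one {Φ : H × ℝ → E} (hΦ : ContDiff ℝ 1 Φ) :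
    ContDiff ℝ 1 (fun z => ∫ t in (0:ℝ)..1, Φ (z, t)) := by
  have hc : Continuous (fun p : H × ℝ => (fderiv ℝ Φ p).comp (ContinuousLinearMap.inl ℝ H ℝ)) := by
    have := hΦ.continuous_fderiv (by norm_num)
    exact this.clm_comp continuous_const
  rw [contDiff_one_iff_fderiv]
  refine ⟨fun z => (param_hasFDerivAt hΦ z).differentiableAt, ?_⟩
  have : fderiv ℝ (fun z => ∫ t in (0:ℝ)..1, Φ (z, t)) = fun z =>
     (∫ t in (0:ℝ)..1, (fderiv ℝ Φ (z, t)).comp (ContinuousLinearMap.inl ℝ H ℝ)) := by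
    ext1 z; exact (param_hasFDerivAt hΦ z).fderiv
  rw [this]
  exact intervalIntegral.continuous_parametric_intervalIntegral_of_continuous' (μ := volume)
    (f := fun z t => (fderiv ℝ Φ (z, t)).comp (ContinuousLinearMap.inl ℝ H ℝ)) hc 0 1

lemma param_contDiff_two {Φ : H × ℝ → E} (hΦ : ContDiff ℝ 2 Φ) :
    ContDiff ℝ 2 (fun z => ∫ t in (0:ℝ)..1, Φ (z, t)) := by
  have h1 : ContDiff ℝ 1 Φ := hΦ.of_le (by norm_num)
  have : fderiv ℝ (fun z => ∫ t in (0:ℝ)..1, Φ (z, t)) = fun z =>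
     (∫ t in (0:ℝ)..1, (fderiv ℝ Φ (z, t)).comp (ContinuousLinearMap.inl ℝ H ℝ)) := by
    ext1 z; exact (param_hasFDerivAt h1 z).fderiv
  have h2 : ContDiff ℝ (1 + 1) (fun z => ∫ t in (0:ℝ)..1, Φ (z, t)) := by
    rw [contDiff_succ_iff_fderiv]
    refine ⟨fun z => (param_hasFDerivAt h1 z).differentiableAt, by simp, ?_⟩
    rw [this]
    apply param_contDiff_one (Φ := fun p : H × ℝ => (fderiv ℝ Φ p).comp (ContinuousLinearMap.inl ℝ H ℝ))
    have : ContDiff ℝ 1 (fderiv ℝ Φ) := hΦ.fderiv_right (by norm_num)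
    exact this.clm_comp contDiff_const
  rw [show (2 : WithTop ℕ∞) = 1 + 1 by norm_num]; exact h2

lemma param_fderiv_apply {Φ : H × ℝ → E} (hΦ : ContDiff ℝ 1 Φ) (z v : H) :
    fderiv ℝ (fun z => ∫ t in (0:ℝ)..1, Φ (z, t)) z v =
      ∫ t in (0:ℝ)..1, fderiv ℝ (fun z => Φ (z, t)) z v := by
  have hc : Continuous (fun p : H × ℝ => (fderiv ℝ Φ p).comp (ContinuousLinearMap.inl ℝ H ℝ)) := by
    have := hΦ.continuous_fderiv (by norm_num)
    exact this.clm_comp continuous_const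
  rw [(param_hasFDerivAt hΦ z).fderiv, ContinuousLinearMap.intervalIntegral_apply]
  · congr 1
    ext t
    have h1 : HasFDerivAt (fun x : H => (x, t)) (ContinuousLinearMap.inl ℝ H ℝ) z :=
      hasFDerivAt_prodMk_left z t
    have := ((hΦ.differentiable (by norm_num) (z, t)).hasFDerivAt.comp z h1)
    rw [show (fun z => Φ (z, t)) = Φ ∘ (fun x : H => (x, t)) from rfl, this.fderiv]
  · exact (hc.comp (by fun_prop : Continuous fun t : ℝ => (z, t))).intervalIntegrable _ _

/-- second derivative under the integral sign -/
lemma param_fderiv2_apply {Φ : H × ℝ → E} (hΦ : ContDiff ℝ 2 Φ) (z v : H) :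
    fderiv ℝ (fun y => fderiv ℝ (fun z => ∫ t in (0:ℝ)..1, Φ (z, t)) y v) z v =
      ∫ t in (0:ℝ)..1, fderiv ℝ (fun y => fderiv ℝ (fun z => Φ (z, t)) y v) z v := by
  have h1 : ContDiff ℝ 1 Φ := hΦ.of_le (by norm_num)
  have e1 : (fun y => fderiv ℝ (fun z => ∫ t in (0:ℝ)..1, Φ (z, t)) y v) =
      fun y => ∫ t in (0:ℝ)..1, fderiv ℝ Φ (y, t) (v, 0) := by
    ext y
    rw [param_fderiv_apply h1]
    congr 1; ext t
    have h1' : HasFDerivAt (fun x : H => (x, t)) (ContinuousLinearMap.inl ℝ H ℝ) y :=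
      hasFDerivAt_prodMk_left y t
    have := ((h1.differentiable (by norm_num) (y, t)).hasFDerivAt.comp y h1')
    rw [show (fun z => Φ (z, t)) = Φ ∘ (fun x : H => (x, t)) from rfl, this.fderiv]
    simp
  have hΨ : ContDiff ℝ 1 (fun p : H × ℝ => fderiv ℝ Φ p (v, 0)) := by
    have : ContDiff ℝ 1 (fderiv ℝ Φ) := hΦ.fderiv_right (by norm_num)
    exact this.clm_apply contDiff_const
  rw [e1, param_fderiv_apply hΨ]
  congr 1; ext t
  congr 2
  ext y
  have h1' : HasFDerivAt (fun x : H => (x, t)) (ContinuousLinearMap.inl ℝ H ℝ) y :=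
    hasFDerivAt_prodMk_left y t
  have := ((h1.differentiable (by norm_num) (y, t)).hasFDerivAt.comp y h1')
  rw [show (fun z => Φ (z, t)) = Φ ∘ (fun x : H => (x, t)) from rfl, this.fderiv]
  simp
end param

/-- Bessel-type series -/
noncomputable def bess (j : ℕ) (x : ℝ) : ℝ := ∑' n : ℕ, x ^ n / (n.factorial * (n + j + 1).factorial)

lemma bess_summable (j : ℕ) (x : ℝ) :
    Summable (fun n : ℕ => x ^ n / (n.factorial * (n + j + 1).factorial : ℝ)) := by
  apply Summable.of_norm_bounded (g := fun n : ℕ => |x| ^ n / n.factorial)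
    (Real.summable_pow_div_factorial |x|)
  intro n
  rw [norm_div, norm_pow, Real.norm_eq_abs]
  have h1 : (1:ℝ) ≤ (n + j + 1).factorial := by exact_mod_cast Nat.factorial_pos _
  have h2 : (0:ℝ) < n.factorial := by exact_mod_cast Nat.factorial_pos _
  rw [Real.norm_of_nonneg (by positivity)]
  gcongr
  nlinarith

lemma bess_hasDerivAt (j : ℕ) (x : ℝ) : HasDerivAt (bess j) (bess (j + 1) x) x := by
  have key := hasDerivAt_tsum_of_isPreconnected (𝕜 := ℝ) (F := ℝ)
    (g := fun (n : ℕ) (y : ℝ) => y ^ n / (n.factorial * (n + j + 1).factorial : ℝ))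
    (g' := fun (n : ℕ) (y : ℝ) => n * y ^ (n - 1) / (n.factorial * (n + j + 1).factorial : ℝ))
    (u := fun n : ℕ => n * (|x| + 1) ^ (n - 1) / (n.factorial : ℝ))
    (t := ball 0 (|x| + 1)) (y₀ := 0) (y := x) ?_ isOpen_ball
    (convex_ball (0:ℝ) _).isPreconnected ?_ ?_ ?_ ?_ ?_
  · have e : bess (j + 1) x = ∑' n : ℕ, n * x ^ (n - 1) / (n.factorial * (n + j + 1).factorial : ℝ) := by
      have hs : Summable (fun n : ℕ => n * x ^ (n - 1) / (n.factorial * (n + j + 1).factorial : ℝ)) := by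
        rw [← summable_nat_add_iff 1]
        refine (bess_summable (j + 1) x).congr fun n => ?_
        rw [show n + 1 + j + 1 = n + (j + 1) + 1 by ring, Nat.factorial_succ n]
        have h2 : (n.factorial : ℝ) ≠ 0 := by exact_mod_cast Nat.factorial_ne_zero _
        have h3 : ((n + (j + 1) + 1).factorial : ℝ) ≠ 0 := by exact_mod_cast Nat.factorial_ne_zero _
        have h4 : (n : ℝ) + 1 ≠ 0 := by positivity
        push_cast
        try simp only [Nat.add_sub_cancel, add_tsub_cancel_right]
        field_simp
      rw [hs.tsum_eq_zero_add]
      simp only [CharP.cast_eq_zero, zero_mul, zero_div, zero_add, bess]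
      refine tsum_congr fun n => ?_
      rw [show n + 1 + j + 1 = n + (j + 1) + 1 by ring, Nat.factorial_succ n]
      have h2 : (n.factorial : ℝ) ≠ 0 := by exact_mod_cast Nat.factorial_ne_zero _
      have h3 : ((n + (j + 1) + 1).factorial : ℝ) ≠ 0 := by exact_mod_cast Nat.factorial_ne_zero _
      have h4 : (n : ℝ) + 1 ≠ 0 := by positivity
      push_cast
      try simp only [Nat.add_sub_cancel, add_tsub_cancel_right]
      field_simp
    rw [e]; exact key
  · rw [← summable_nat_add_iff 1]
    refine (Real.summable_pow_div_factorial (|x| + 1)).congr fun n => ?_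
    rw [Nat.factorial_succ n]
    have h2 : (n.factorial : ℝ) ≠ 0 := by exact_mod_cast Nat.factorial_ne_zero _
    have h4 : (n : ℝ) + 1 ≠ 0 := by positivity
    push_cast
    try simp only [Nat.add_sub_cancel, add_tsub_cancel_right]
    field_simp
  · intro n y _
    have := (hasDerivAt_pow n y).div_const (n.factorial * (n + j + 1).factorial : ℝ)
    exact this
  · intro n y hy
    rw [mem_ball_zero_iff, Real.norm_eq_abs] at hy
    have h1 : (1:ℝ) ≤ (n + j + 1).factorial := by exact_mod_cast Nat.factorial_pos _
    have h2 : (0:ℝ) < n.factorial := by exact_mod_cast Nat.factorial_pos _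
    rw [norm_div, norm_mul, norm_pow, Real.norm_eq_abs y,
      Real.norm_of_nonneg (by positivity : (0:ℝ) ≤ n.factorial * (n + j + 1).factorial)]
    simp only [Real.norm_natCast]
    gcongr
    nlinarith
  · simp; positivity
  · exact bess_summable j 0
  · simp

lemma bess_rec (x : ℝ) : x * bess 2 x + 2 * bess 1 x = bess 0 x := by
  unfold bess
  have hs1 : Summable (fun n : ℕ => n * x ^ n / (n.factorial * (n + 1 + 1).factorial : ℝ)) := by
    rw [← summable_nat_add_iff 1]
    refine ((bess_summable 2 x).mul_left x).congr fun n => ?_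
    rw [show n + 1 + 1 + 1 = n + 2 + 1 by ring, Nat.factorial_succ n]
    have h2 : (n.factorial : ℝ) ≠ 0 := by exact_mod_cast Nat.factorial_ne_zero _
    have h3 : ((n + 2 + 1).factorial : ℝ) ≠ 0 := by exact_mod_cast Nat.factorial_ne_zero _
    have h4 : (n : ℝ) + 1 ≠ 0 := by positivity
    push_cast
    field_simp
    ring
  have e1 : x * ∑' n : ℕ, x ^ n / (n.factorial * (n + 2 + 1).factorial : ℝ) =
      ∑' n : ℕ, n * x ^ n / (n.factorial * (n + 1 + 1).factorial : ℝ) := by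
    rw [hs1.tsum_eq_zero_add, ← tsum_mul_left]
    simp only [CharP.cast_eq_zero, zero_mul, zero_div, zero_add]
    refine tsum_congr fun n => ?_
    rw [show n + 1 + 1 + 1 = n + 2 + 1 by ring, Nat.factorial_succ n]
    have h2 : (n.factorial : ℝ) ≠ 0 := by exact_mod_cast Nat.factorial_ne_zero _
    have h3 : ((n + 2 + 1).factorial : ℝ) ≠ 0 := by exact_mod_cast Nat.factorial_ne_zero _
    have h4 : (n : ℝ) + 1 ≠ 0 := by positivity
    push_cast
    field_simp
    ring
  rw [e1, ← tsum_mul_left, ← hs1.tsum_add ((bess_summable 1 x).mul_left 2)]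
  refine tsum_congr fun n => ?_
  rw [show n + 0 + 1 = n + 1 by ring, Nat.factorial_succ (n + 1)]
  have h2 : (n.factorial : ℝ) ≠ 0 := by exact_mod_cast Nat.factorial_ne_zero _
  have h3 : ((n + 1).factorial : ℝ) ≠ 0 := by exact_mod_cast Nat.factorial_ne_zero _
  have h4 : (n : ℝ) + 1 + 1 ≠ 0 := by positivity
  push_cast
  field_simp
  ring

lemma bess_contDiff (n : ℕ) : ∀ j, ContDiff ℝ n (bess j) := by
  induction n with
  | zero =>
    intro j
    have : Continuous (bess j) := continuous_iff_continuousAt.2 fun x => (bess_hasDerivAt j x).continuousAt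
    exact_mod_cast contDiff_zero.2 this
  | succ n ih =>
    intro j
    push_cast
    rw [contDiff_succ_iff_deriv]
    refine ⟨fun x => (bess_hasDerivAt j x).differentiableAt, by simp, ?_⟩
    have : deriv (bess j) = bess (j + 1) := by ext x; exact (bess_hasDerivAt j x).deriv
    rw [this]; exact ih _

lemma exists_G (c : ℝ) : ∃ G G1 G2 : ℝ → ℝ, (∀ x, HasDerivAt G (G1 x) x) ∧
    (∀ x, HasDerivAt G1 (G2 x) x) ∧ ContDiff ℝ 2 G ∧ G 0 = c ∧
    ∀ x, x * G2 x + 2 * G1 x = c * G x := by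
  have hl : ∀ x : ℝ, HasDerivAt (fun x => c * x) c x := fun x => by
    simpa using (hasDerivAt_id x).const_mul c
  refine ⟨fun x => c * bess 0 (c * x), fun x => c ^ 2 * bess 1 (c * x), fun x => c ^ 3 * bess 2 (c * x),
    ?_, ?_, ?_, ?_, ?_⟩
  · intro x
    have := ((bess_hasDerivAt 0 (c * x)).comp x (hl x)).const_mul c
    refine HasDerivAt.congr_deriv (f := fun x => c * bess 0 (c * x)) this ?_
    show _ * (bess 1 (c * x) * c) = _ * bess 1 (c * x)
    ring
  · intro x
    have := ((bess_hasDerivAt 1 (c * x)).comp x (hl x)).const_mul (c ^ 2)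
    refine HasDerivAt.congr_deriv (f := fun x => c ^ 2 * bess 1 (c * x)) this ?_
    show _ * (bess 2 (c * x) * c) = _ * bess 2 (c * x)
    ring
  · have := bess_contDiff 2 0
    exact contDiff_const.mul (this.comp (contDiff_const.mul contDiff_id))
  · have : bess 0 0 = 1 := by
      unfold bess
      rw [tsum_eq_single 0]
      · simp
      · intro b hb; simp [hb]
    simp [this]
  · intro x
    have := bess_rec (c * x)
    linear_combination c ^ 2 * this

end CornerAux

namespace CornerAux
open Filter Topology

lemma dX_eq_of {E : Type*} [NormedAddCommGroup E] [NormedSpace ℝ E] {f : ℂ → E} {z : ℂ}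
    {L : ℂ →L[ℝ] E} (h : HasFDerivAt f L z) : dX f z = L 1 := by
  unfold dX; rw [h.fderiv]
lemma dY_eq_of {E : Type*} [NormedAddCommGroup E] [NormedSpace ℝ E] {f : ℂ → E} {z : ℂ}
    {L : ℂ →L[ℝ] E} (h : HasFDerivAt f L z) : dY f z = L Complex.I := by
  unfold dY; rw [h.fderiv]

lemma hasFDerivAt_re (z : ℂ) : HasFDerivAt (fun z : ℂ => z.re) Complex.reCLM z :=
  Complex.reCLM.hasFDerivAt
lemma hasFDerivAt_im (z : ℂ) : HasFDerivAt (fun z : ℂ => z.im) Complex.imCLM z :=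
  Complex.imCLM.hasFDerivAt

lemma hasFDerivAt_sq (z : ℂ) : HasFDerivAt (fun z : ℂ => z.re ^ 2 + z.im ^ 2)
    ((2 * z.re) • Complex.reCLM + (2 * z.im) • Complex.imCLM) z := by
  have := ((hasFDerivAt_re z).pow 2).add ((hasFDerivAt_im z).pow 2)
  have e : ((2 * z.re) • Complex.reCLM + (2 * z.im) • Complex.imCLM : ℂ →L[ℝ] ℝ) =
      ((2 • z.re ^ (2 - 1)) • Complex.reCLM + (2 • z.im ^ (2 - 1)) • Complex.imCLM) := by
    ext <;> simp
  rw [e]; exact this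

/-- radial functions -/
lemma dX_radial {F F1 : ℝ → ℝ} (hF : ∀ x, HasDerivAt F (F1 x) x) (z : ℂ) :
    dX (fun z : ℂ => ((F (z.re ^ 2 + z.im ^ 2) : ℝ) : ℂ)) z = ((2 * z.re * F1 (z.re ^ 2 + z.im ^ 2) : ℝ) : ℂ) := by
  have h := Complex.ofRealCLM.hasFDerivAt.comp z ((hF _).hasFDerivAt.comp z (hasFDerivAt_sq z))
  rw [dX_eq_of (f := (fun z : ℂ => ((F (z.re ^ 2 + z.im ^ 2) : ℝ) : ℂ))) h]
  simp

lemma dY_radial {F F1 : ℝ → ℝ} (hF : ∀ x, HasDerivAt F (F1 x) x) (z : ℂ) :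
    dY (fun z : ℂ => ((F (z.re ^ 2 + z.im ^ 2) : ℝ) : ℂ)) z = ((2 * z.im * F1 (z.re ^ 2 + z.im ^ 2) : ℝ) : ℂ) := by
  have h := Complex.ofRealCLM.hasFDerivAt.comp z ((hF _).hasFDerivAt.comp z (hasFDerivAt_sq z))
  rw [dY_eq_of (f := (fun z : ℂ => ((F (z.re ^ 2 + z.im ^ 2) : ℝ) : ℂ))) h]
  simp

lemma lapC_radial {F F1 F2 : ℝ → ℝ} (hF : ∀ x, HasDerivAt F (F1 x) x)
    (hF1 : ∀ x, HasDerivAt F1 (F2 x) x) (z : ℂ) :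
    lapC (fun z : ℂ => ((F (z.re ^ 2 + z.im ^ 2) : ℝ) : ℂ)) z =
      ((4 * F1 (z.re ^ 2 + z.im ^ 2) + 4 * (z.re ^ 2 + z.im ^ 2) * F2 (z.re ^ 2 + z.im ^ 2) : ℝ) : ℂ) := by
  have e1 : dX (fun z : ℂ => ((F (z.re ^ 2 + z.im ^ 2) : ℝ) : ℂ)) =
      fun z => ((2 * z.re * F1 (z.re ^ 2 + z.im ^ 2) : ℝ) : ℂ) := by ext1 z; exact dX_radial hF z
  have e2 : dY (fun z : ℂ => ((F (z.re ^ 2 + z.im ^ 2) : ℝ) : ℂ)) =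
      fun z => ((2 * z.im * F1 (z.re ^ 2 + z.im ^ 2) : ℝ) : ℂ) := by ext1 z; exact dY_radial hF z
  unfold lapC
  rw [e1, e2]
  have h := ((hF1 _).hasFDerivAt.comp z (hasFDerivAt_sq z))
  have hx := Complex.ofRealCLM.hasFDerivAt.comp z (((hasFDerivAt_re z).const_mul 2).mul h)
  have hy := Complex.ofRealCLM.hasFDerivAt.comp z (((hasFDerivAt_im z).const_mul 2).mul h)
  rw [dX_eq_of (f := (fun z : ℂ => ((2 * z.re * F1 (z.re ^ 2 + z.im ^ 2) : ℝ) : ℂ))) hx,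
    dY_eq_of (f := (fun z : ℂ => ((2 * z.im * F1 (z.re ^ 2 + z.im ^ 2) : ℝ) : ℂ))) hy]
  simp
  ring

lemma hasFDerivAt_scale (t : ℝ) (z : ℂ) : HasFDerivAt (fun z : ℂ => t • z)
    (t • ContinuousLinearMap.id ℝ ℂ) z := (t • ContinuousLinearMap.id ℝ ℂ).hasFDerivAt

lemma dX_scale {v : ℂ → ℂ} (hv : Differentiable ℝ v) (t : ℝ) (z : ℂ) :
    dX (fun z => v (t • z)) z = t • dX v (t • z) := by
  have := (hv (t • z)).hasFDerivAt.comp z (hasFDerivAt_scale t z)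
  rw [dX_eq_of (f := fun z => v (t • z)) this]
  simp only [ContinuousLinearMap.comp_apply, _root_.smul_apply, map_smul, dX, ContinuousLinearMap.id_apply]

lemma dY_scale {v : ℂ → ℂ} (hv : Differentiable ℝ v) (t : ℝ) (z : ℂ) :
    dY (fun z => v (t • z)) z = t • dY v (t • z) := by
  have := (hv (t • z)).hasFDerivAt.comp z (hasFDerivAt_scale t z)
  rw [dY_eq_of (f := fun z => v (t • z)) this]
  simp only [ContinuousLinearMap.comp_apply, _root_.smul_apply, map_smul, dY, ContinuousLinearMap.id_apply]

lemma dX_const_smul {f : ℂ → ℂ} (hf : Differentiable ℝ f) (t : ℝ) (z : ℂ) :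
    dX (fun z => t • f z) z = t • dX f z := by
  rw [dX_eq_of (f := fun z => t • f z) ((hf z).hasFDerivAt.const_smul t)]; rfl

lemma dY_const_smul {f : ℂ → ℂ} (hf : Differentiable ℝ f) (t : ℝ) (z : ℂ) :
    dY (fun z => t • f z) z = t • dY f z := by
  rw [dY_eq_of (f := fun z => t • f z) ((hf z).hasFDerivAt.const_smul t)]; rfl

lemma lapC_scale {v : ℂ → ℂ} (hv : ContDiff ℝ 2 v) (t : ℝ) (z : ℂ) :
    lapC (fun z => v (t • z)) z = (t ^ 2 : ℝ) • lapC v (t • z) := by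
  have e1 : dX (fun z => v (t • z)) = fun z => t • dX v (t • z) := by
    ext1 z; exact dX_scale (C2.d hv) t z
  have e2 : dY (fun z => v (t • z)) = fun z => t • dY v (t • z) := by
    ext1 z; exact dY_scale (C2.d hv) t z
  have hs : Differentiable ℝ (fun z : ℂ => t • z) := fun z => (hasFDerivAt_scale t z).differentiableAt
  unfold lapC
  rw [e1, e2, dX_const_smul (f := fun z => dX v (t • z)) ((C2.dXd hv).comp hs), dY_const_smul (f := fun z => dY v (t • z)) ((C2.dYd hv).comp hs)]
  rw [dX_scale (C2.dXd hv), dY_scale (C2.dYd hv)]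
  simp only [smul_add, smul_smul, pow_two]

lemma hasDerivAt_ray {v : ℂ → ℂ} (hv : Differentiable ℝ v) (t : ℝ) (z : ℂ) :
    HasDerivAt (fun t : ℝ => v (t • z)) (z.re • dX v (t • z) + z.im • dY v (t • z)) t := by
  have h1 : HasDerivAt (fun t : ℝ => t • z) z t := by simpa using (hasDerivAt_id t).smul_const z
  have := (hv (t • z)).hasFDerivAt.comp_hasDerivAt t h1
  rw [fderiv_eq_dXY] at this
  exact this

/-- Vekua transform: Helmholtz to harmonic -/
lemma vekua (c : ℝ) {v : ℂ → ℂ} (hv : ContDiff ℝ 2 v) (hpde : ∀ z, lapC v z = -(4 * c : ℝ) * v z) :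
    ∃ m : ℂ × ℝ → ℝ, Continuous m ∧ (ContDiff ℝ 2 fun z => v z + ∫ t in (0:ℝ)..1,
        (((z.re ^ 2 + z.im ^ 2) * m (z, t) : ℝ) : ℂ) * v (t • z)) ∧
      ∀ z, lapC (fun z => v z + ∫ t in (0:ℝ)..1,
        (((z.re ^ 2 + z.im ^ 2) * m (z, t) : ℝ) : ℂ) * v (t • z)) z = 0 := by
  obtain ⟨G, G1, G2, hG, hG1, hGc, hG0, hGr⟩ := exists_G c
  set Φ : ℂ × ℝ → ℂ := fun p => (((p.1.re ^ 2 + p.1.im ^ 2) *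
    G ((p.1.re ^ 2 + p.1.im ^ 2) * (p.2 * (1 - p.2))) : ℝ) : ℂ) * v (p.2 • p.1) with hΦdef
  have hre : ContDiff ℝ 2 (fun p : ℂ × ℝ => p.1.re) := Complex.reCLM.contDiff.comp contDiff_fst
  have him : ContDiff ℝ 2 (fun p : ℂ × ℝ => p.1.im) := Complex.imCLM.contDiff.comp contDiff_fst
  have hr : ContDiff ℝ 2 (fun p : ℂ × ℝ => G ((p.1.re ^ 2 + p.1.im ^ 2) * (p.2 * (1 - p.2)))) := by
    refine hGc.comp ?_
    exact ((hre.pow 2).add (him.pow 2)).mul (contDiff_snd.mul (contDiff_const.sub contDiff_snd))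
  have hΦ : ContDiff ℝ 2 Φ := by
    refine ContDiff.mul ?_ ?_
    · exact Complex.ofRealCLM.contDiff.comp (((hre.pow 2).add (him.pow 2)).mul hr)
    · exact hv.comp (contDiff_snd.smul contDiff_fst)
  have hI : ContDiff ℝ 2 (fun z => ∫ t in (0:ℝ)..1, Φ (z, t)) := param_contDiff_two hΦ
  refine ⟨fun p => G ((p.1.re ^ 2 + p.1.im ^ 2) * (p.2 * (1 - p.2))), hr.continuous, hv.add hI, ?_⟩
  intro z
  change lapC (fun z => v z + ∫ t in (0:ℝ)..1, Φ (z, t)) z = 0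
  rw [lapC_add hv hI, hpde]
  have hcont : ∀ w : ℂ, Continuous (fun t : ℝ => fderiv ℝ (fun y => fderiv ℝ (fun z => Φ (z, t)) y w) z w) := by
    intro w
    have h1 : ContDiff ℝ 1 Φ := hΦ.of_le (by norm_num)
    have hΨ : ContDiff ℝ 1 (fun p : ℂ × ℝ => fderiv ℝ Φ p (w, 0)) := by
      have : ContDiff ℝ 1 (fderiv ℝ Φ) := hΦ.fderiv_right (by norm_num)
      exact this.clm_apply contDiff_const
    have e : (fun t : ℝ => fderiv ℝ (fun y => fderiv ℝ (fun z => Φ (z, t)) y w) z w) =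
        fun t => fderiv ℝ (fun p : ℂ × ℝ => fderiv ℝ Φ p (w, 0)) (z, t) (w, 0) := by
      ext1 t
      have h1' : ∀ y : ℂ, HasFDerivAt (fun x : ℂ => (x, t)) (ContinuousLinearMap.inl ℝ ℂ ℝ) y :=
        fun y => hasFDerivAt_prodMk_left y t
      have e1 : (fun y => fderiv ℝ (fun z => Φ (z, t)) y w) =
          (fun p : ℂ × ℝ => fderiv ℝ Φ p (w, 0)) ∘ (fun x : ℂ => (x, t)) := by
        ext1 y
        have := ((h1.differentiable (by norm_num) (y, t)).hasFDerivAt.comp y (h1' y))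
        rw [show (fun z => Φ (z, t)) = Φ ∘ (fun x : ℂ => (x, t)) from rfl, this.fderiv]
        simp
      rw [e1]
      have := ((hΨ.differentiable (by norm_num) (z, t)).hasFDerivAt.comp z (h1' z))
      rw [this.fderiv]
      simp
    rw [e]
    have := (hΨ.continuous_fderiv (by norm_num)).comp (by fun_prop : Continuous fun t : ℝ => (z, t))
    exact this.clm_apply continuous_const
  have hlapI : lapC (fun z => ∫ t in (0:ℝ)..1, Φ (z, t)) z
      = ∫ t in (0:ℝ)..1, lapC (fun z => Φ (z, t)) z := by
    have hx := param_fderiv2_apply hΦ z 1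
    have hy := param_fderiv2_apply hΦ z Complex.I
    unfold lapC dX dY
    rw [hx, hy, ← intervalIntegral.integral_add]
    · exact (hcont 1).intervalIntegrable _ _
    · exact (hcont Complex.I).intervalIntegrable _ _
  rw [hlapI]
  set p : ℝ := z.re ^ 2 + z.im ^ 2 with hp
  have hl : ∀ a : ℝ, ∀ x : ℝ, HasDerivAt (fun x => x * a) a x := fun a x => by
    simpa using (hasDerivAt_id x).mul_const a
  -- the primitive
  set S : ℝ → ℂ := fun t => ((4 * t * (G (p * (t * (1 - t))) + p * (t * (1 - t)) * G1 (p * (t * (1 - t)))) : ℝ) : ℂ)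
    * v (t • z) with hS
  have hSd : ∀ t : ℝ, HasDerivAt S (lapC (fun z => Φ (z, t)) z) t := by
    intro t
    set τ := t * (1 - t) with hτ
    have hF : ∀ x, HasDerivAt (fun x => x * G (x * τ)) (G (x * τ) + x * τ * G1 (x * τ)) x := by
      intro x
      have := (hasDerivAt_id x).mul ((hG (x * τ)).comp x (hl τ x))
      refine HasDerivAt.congr_deriv (f := fun x => x * G (x * τ)) this ?_
      simp; ring
    have hF1 : ∀ x, HasDerivAt (fun x => G (x * τ) + x * τ * G1 (x * τ))
        (τ * (2 * G1 (x * τ) + x * τ * G2 (x * τ))) x := by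
      intro x
      have := ((hG (x * τ)).comp x (hl τ x)).add ((hl τ x).mul ((hG1 (x * τ)).comp x (hl τ x)))
      refine HasDerivAt.congr_deriv (f := fun x => G (x * τ) + x * τ * G1 (x * τ)) this ?_
      simp; ring
    have hfst : ContDiff ℝ 2 (fun z : ℂ => (((fun x => x * G (x * τ)) (z.re ^ 2 + z.im ^ 2) : ℝ) : ℂ)) := by
      refine Complex.ofRealCLM.contDiff.comp ?_
      have h1 : ContDiff ℝ 2 (fun z : ℂ => z.re ^ 2 + z.im ^ 2) :=
        (Complex.reCLM.contDiff.pow 2).add (Complex.imCLM.contDiff.pow 2)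
      exact h1.mul (hGc.comp (h1.mul contDiff_const))
    have hsnd : ContDiff ℝ 2 (fun z : ℂ => v (t • z)) := hv.comp (g := v) (f := fun z : ℂ => t • z) (contDiff_const_smul t)
    have hlap := lapC_mul hfst hsnd z
    have e0 : lapC (fun z => Φ (z, t)) z = lapC (fun z : ℂ => (((fun x => x * G (x * τ)) (z.re ^ 2 + z.im ^ 2) : ℝ) : ℂ)
      * v (t • z)) z := rfl
    rw [e0, hlap, lapC_radial hF hF1, dX_radial hF, dY_radial hF, lapC_scale hv, hpde,
      dX_scale (C2.d hv), dY_scale (C2.d hv), ← hp]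
    have hτd : HasDerivAt (fun t : ℝ => p * (t * (1 - t))) (p * (1 - 2 * t)) t := by
      have := ((hasDerivAt_id t).mul ((hasDerivAt_id t).const_sub 1)).const_mul p
      refine HasDerivAt.congr_deriv (f := fun t : ℝ => p * (t * (1 - t))) this ?_
      show p * (1 * (1 - t) + t * -1) = _
      ring
    have hA : HasDerivAt (fun t => 4 * t * (G (p * (t * (1 - t))) + p * (t * (1 - t)) * G1 (p * (t * (1 - t)))))
        (4 * (G (p * τ) + p * τ * G1 (p * τ)) + 4 * t * (p * (1 - 2 * t)) * (2 * G1 (p * τ) + p * τ * G2 (p * τ))) t := by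
      have := ((hasDerivAt_id t).const_mul 4).mul (((hG (p * τ)).comp t hτd).add (hτd.mul ((hG1 (p * τ)).comp t hτd)))
      refine HasDerivAt.congr_deriv (f := (fun t => 4 * t * (G (p * (t * (1 - t))) + p * (t * (1 - t)) * G1 (p * (t * (1 - t)))))) this ?_
      simp [← hτ]; ring
    have := (Complex.ofRealCLM.hasFDerivAt.comp_hasDerivAt t hA).mul (hasDerivAt_ray (C2.d hv) t z)
    refine HasDerivAt.congr_deriv (f := S) this ?_
    have hrr : ((p * τ * G2 (p * τ) + 2 * G1 (p * τ) : ℝ) : ℂ) = ((c * G (p * τ) : ℝ) : ℂ) := by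
      rw [hGr]
    have hτc : (τ : ℂ) = t * (1 - t) := by rw [hτ]; push_cast; ring
    simp only [Function.comp, Complex.ofRealCLM_apply, Complex.real_smul, ← hτ]
    push_cast at hrr ⊢
    rw [hτc] at hrr ⊢
    linear_combination (-4 * (p:ℂ) * t ^ 2 * v (t * z)) * hrr
  rw [intervalIntegral.integral_eq_sub_of_hasDerivAt (fun t _ => hSd t)]
  · simp [hS, hG0]
  · have hcl : Continuous (fun t : ℝ => lapC (fun z => Φ (z, t)) z) :=
      (hcont 1).add (hcont Complex.I)
    exact hcl.intervalIntegrable _ _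

end CornerAux

namespace CornerAux
open Filter Topology
open scoped ComplexConjugate

lemma harmonic_decomp {h : ℂ → ℂ} (hh : ContDiff ℝ 2 h) (hl : ∀ z, lapC h z = 0) :
    ∃ A B : ℂ → ℂ, AnalyticOnNhd ℂ A univ ∧ AnalyticOnNhd ℂ B univ ∧ B 0 = 0 ∧
      ∀ z, h z = A z + conj (B z) := by
  have hharm : InnerProductSpace.HarmonicOnNhd h univ := by
    intro x _
    refine ⟨hh.contDiffAt, Eventually.of_forall fun z => ?_⟩
    rw [InnerProductSpace.laplacian_eq_iteratedFDeriv_complexPlane]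
    have h1 : DifferentiableAt ℝ (fderiv ℝ h) z :=
      (hh.fderiv_right (m := 1) (by norm_num)).differentiable (by norm_num) z
    have e1 : dX (dX h) z = fderiv ℝ (fderiv ℝ h) z 1 1 := by
      unfold dX
      rw [fderiv_clm_apply h1 (by fun_prop)]; simp
    have e2 : dY (dY h) z = fderiv ℝ (fderiv ℝ h) z Complex.I Complex.I := by
      unfold dY
      rw [fderiv_clm_apply h1 (by fun_prop)]; simp
    have := hl z
    unfold lapC at this
    rw [e1, e2] at this
    simp [iteratedFDeriv_two_apply, this]
  obtain ⟨F1, hF1, e1⟩ := (hharm.comp_CLM Complex.reCLM).exists_analyticOnNhd_univ_re_eq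
  obtain ⟨F2, hF2, e2⟩ := (hharm.comp_CLM Complex.imCLM).exists_analyticOnNhd_univ_re_eq
  set B : ℂ → ℂ := fun z => (F1 z - Complex.I * F2 z) / 2 with hB
  refine ⟨fun z => (F1 z + Complex.I * F2 z) / 2 + conj (B 0), fun z => B z - B 0, ?_, ?_, by simp, ?_⟩
  · intro z hz
    have a1 := hF1 z hz
    have a2 := hF2 z hz
    fun_prop (disch := norm_num)
  · intro z hz
    have a1 := hF1 z hz
    have a2 := hF2 z hz
    simp only [hB]
    fun_prop (disch := norm_num)
  · intro z
    have e1' : (F1 z).re = (h z).re := congrFun e1 z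
    have e2' : (F2 z).re = (h z).im := congrFun e2 z
    have h2c : conj (2:ℂ) = 2 := Complex.conj_ofNat _
    simp only [hB, map_sub, map_div₀, map_mul, Complex.conj_I, h2c]
    apply Complex.ext
    · rw [← e1']; simp; ring
    · rw [← e2']; simp; ring

lemma harmonic_leading {h : ℂ → ℂ} (hh : ContDiff ℝ 2 h) (hl : ∀ z, lapC h z = 0) :
    (∀ z, h z = 0) ∨ ∃ (N : ℕ) (a b : ℂ) (δ C : ℝ), (a ≠ 0 ∨ b ≠ 0) ∧ (N = 0 → b = 0) ∧ 0 < δ ∧ 0 ≤ C ∧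
      ∀ z : ℂ, ‖z‖ ≤ δ → ‖h z - (a * z ^ N + b * conj z ^ N)‖ ≤ C * ‖z‖ ^ (N + 1) := by
  obtain ⟨A, B, hA, hB, hB0, hdec⟩ := harmonic_decomp hh hl
  by_cases htop : analyticOrderAt A 0 = ⊤ ∧ analyticOrderAt B 0 = ⊤
  · left
    have h1 : A = 0 := by
      have := hA.eqOn_zero_of_preconnected_of_eventuallyEq_zero isPreconnected_univ (mem_univ 0)
        (analyticOrderAt_eq_top.1 htop.1)
      ext z; exact this (mem_univ z)
    have h2 : B = 0 := by
      have := hB.eqOn_zero_of_preconnected_of_eventuallyEq_zero isPreconnected_univ (mem_univ 0)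
        (analyticOrderAt_eq_top.1 htop.2)
      ext z; exact this (mem_univ z)
    intro z; simp [hdec, h1, h2]
  · right
    have hmin : min (analyticOrderAt A 0) (analyticOrderAt B 0) ≠ ⊤ := by
      intro h; rw [min_eq_top] at h; exact htop h
    obtain ⟨N, hN⟩ := ENat.ne_top_iff_exists.1 hmin
    have hNA : (N : ℕ∞) ≤ analyticOrderAt A 0 := by rw [hN]; exact min_le_left _ _
    have hNB : (N : ℕ∞) ≤ analyticOrderAt B 0 := by rw [hN]; exact min_le_right _ _
    obtain ⟨A1, hA1, eA⟩ := (natCast_le_analyticOrderAt (hA 0 (mem_univ _))).1 hNA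
    obtain ⟨B1, hB1, eB⟩ := (natCast_le_analyticOrderAt (hB 0 (mem_univ _))).1 hNB
    have hne : A1 0 ≠ 0 ∨ B1 0 ≠ 0 := by
      rcases min_choice (analyticOrderAt A 0) (analyticOrderAt B 0) with hm | hm
      · left
        rw [hm] at hN
        obtain ⟨g, hg, hg0, eg⟩ := ((hA 0 (mem_univ _)).analyticOrderAt_eq_natCast).1 hN.symm
        have : A1 =ᶠ[𝓝[≠] 0] g := by
          filter_upwards [eA.filter_mono nhdsWithin_le_nhds, eg.filter_mono nhdsWithin_le_nhds, self_mem_nhdsWithin] with z h1 h2 h3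
          rw [h1] at h2
          simp only [sub_zero, smul_eq_mul] at h2
          exact mul_left_cancel₀ (pow_ne_zero _ h3) h2
        have h0 := (hA1.continuousAt.eventuallyEq_nhds_iff_eventuallyEq_nhdsNE hg.continuousAt).1 this
        rw [h0.eq_of_nhds]; exact hg0
      · right
        rw [hm] at hN
        obtain ⟨g, hg, hg0, eg⟩ := ((hB 0 (mem_univ _)).analyticOrderAt_eq_natCast).1 hN.symm
        have : B1 =ᶠ[𝓝[≠] 0] g := by
          filter_upwards [eB.filter_mono nhdsWithin_le_nhds, eg.filter_mono nhdsWithin_le_nhds, self_mem_nhdsWithin] with z h1 h2 h3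
          rw [h1] at h2
          simp only [sub_zero, smul_eq_mul] at h2
          exact mul_left_cancel₀ (pow_ne_zero _ h3) h2
        have h0 := (hB1.continuousAt.eventuallyEq_nhds_iff_eventuallyEq_nhdsNE hg.continuousAt).1 this
        rw [h0.eq_of_nhds]; exact hg0
    have hlip : ∀ f : ℂ → ℂ, AnalyticAt ℂ f 0 → ∃ C, 0 ≤ C ∧ ∀ᶠ z in 𝓝 (0:ℂ), ‖f z - f 0‖ ≤ C * ‖z‖ := by
      intro f hf
      have := hf.differentiableAt.isBigO_sub
      obtain ⟨C, hC, h⟩ := this.exists_nonneg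
      refine ⟨C, hC, ?_⟩
      have := h.bound
      simpa using this
    obtain ⟨CA, hCA0, hCA⟩ := hlip A1 hA1
    obtain ⟨CB, hCB0, hCB⟩ := hlip B1 hB1
    have hev := (eA.and eB).and (hCA.and hCB)
    obtain ⟨δ, hδ, hball⟩ := Metric.eventually_nhds_iff_ball.1 hev
    refine ⟨N, A1 0, conj (B1 0), δ / 2, CA + CB, ?_, ?_, by positivity, by positivity, ?_⟩
    · rcases hne with h | h
      · exact Or.inl h
      · right; simpa using h
    · intro hN0
      subst hN0
      have := eB.self_of_nhds
      simp [hB0] at this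
      simp [← this]
    · intro z hz
      obtain ⟨⟨h1, h2⟩, h3, h4⟩ := hball z (by rw [mem_ball_zero_iff]; linarith)
      simp only [sub_zero, smul_eq_mul] at h1 h2
      have e : h z - (A1 0 * z ^ N + conj (B1 0) * conj z ^ N) =
          z ^ N * (A1 z - A1 0) + conj (z ^ N * (B1 z - B1 0)) := by
        rw [hdec, h1, h2]; simp only [map_mul, map_sub, map_pow]; ring
      rw [e]
      calc _ ≤ ‖z ^ N * (A1 z - A1 0)‖ + ‖conj (z ^ N * (B1 z - B1 0))‖ := norm_add_le _ _
        _ = ‖z‖ ^ N * ‖A1 z - A1 0‖ + ‖z‖ ^ N * ‖B1 z - B1 0‖ := by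
          simp only [RCLike.norm_conj, norm_mul, norm_pow]
        _ ≤ ‖z‖ ^ N * (CA * ‖z‖) + ‖z‖ ^ N * (CB * ‖z‖) := by gcongr
        _ = _ := by ring

lemma sq_eq_norm (z : ℂ) : z.re ^ 2 + z.im ^ 2 = ‖z‖ ^ 2 := by
  rw [Complex.sq_norm, Complex.normSq_apply]; ring

lemma volterra_bound {v : ℂ → ℂ} {m : ℂ × ℝ → ℝ} {R K : ℝ} (hv : Continuous v) (hm : Continuous m)
    (hK : ∀ z : ℂ, ‖z‖ ≤ R → ∀ t ∈ Icc (0:ℝ) 1, |m (z, t)| ≤ K) {z : ℂ} (hz : ‖z‖ ≤ R) :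
    ‖∫ t in (0:ℝ)..1, (((z.re ^ 2 + z.im ^ 2) * m (z, t) : ℝ) : ℂ) * v (t • z)‖ ≤
      ‖z‖ ^ 2 * K * ∫ t in (0:ℝ)..1, ‖v (t • z)‖ := by
  rw [← intervalIntegral.integral_const_mul]
  refine (intervalIntegral.norm_integral_le_integral_norm zero_le_one).trans ?_
  apply intervalIntegral.integral_mono_on zero_le_one
  · apply Continuous.intervalIntegrable
    have : Continuous fun t : ℝ => m (z, t) := by fun_prop
    fun_prop
  · apply Continuous.intervalIntegrable
    fun_prop
  · intro t ht
    rw [norm_mul, Complex.norm_real, norm_mul, sq_eq_norm, Real.norm_of_nonneg (by positivity : 0 ≤ ‖z‖ ^ 2), Real.norm_eq_abs]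
    gcongr
    exact hK z hz t ht

lemma m_bound {m : ℂ × ℝ → ℝ} (hm : Continuous m) (R : ℝ) :
    ∃ K, 0 ≤ K ∧ ∀ z : ℂ, ‖z‖ ≤ R → ∀ t ∈ Icc (0:ℝ) 1, |m (z, t)| ≤ K := by
  have hc : IsCompact (closedBall (0:ℂ) R ×ˢ Icc (0:ℝ) 1) := (isCompact_closedBall 0 R).prod isCompact_Icc
  obtain ⟨C, hC⟩ := hc.exists_bound_of_continuousOn hm.continuousOn
  refine ⟨max C 0, le_max_right _ _, fun z hz t ht => ?_⟩
  exact (hC (z, t) ⟨by simpa using hz, ht⟩).trans (le_max_left _ _)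

lemma volterra_zero {v : ℂ → ℂ} {m : ℂ × ℝ → ℝ} (hv : Continuous v) (hm : Continuous m)
    (h0 : ∀ z, v z + ∫ t in (0:ℝ)..1, (((z.re ^ 2 + z.im ^ 2) * m (z, t) : ℝ) : ℂ) * v (t • z) = 0) (z : ℂ) :
    v z = 0 := by
  obtain ⟨K, hK0, hK⟩ := m_bound hm ‖z‖
  set ψ : ℝ → ℝ := fun t => ∫ τ in (0:ℝ)..t, ‖v (τ • z)‖ with hψ
  have hcv : Continuous fun τ : ℝ => ‖v (τ • z)‖ := by fun_prop
  have hψd : ∀ t, HasDerivAt ψ ‖v (t • z)‖ t := fun t =>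
    intervalIntegral.integral_hasDerivAt_right (hcv.intervalIntegrable _ _)
      (hcv.stronglyMeasurableAtFilter _ _) hcv.continuousAt
  have hmain : ∀ t ∈ Icc (0:ℝ) 1, ‖v (t • z)‖ ≤ (‖z‖ ^ 2 * K) * ψ t := by
    intro t ht
    have hn : ‖t • z‖ = t * ‖z‖ := by rw [norm_smul, Real.norm_of_nonneg ht.1]
    have hle : ‖t • z‖ ≤ ‖z‖ := by rw [hn]; nlinarith [norm_nonneg z, ht.2]
    have h1 := volterra_bound hv hm hK hle
    have h2 : v (t • z) = - ∫ s in (0:ℝ)..1, ((((t • z).re ^ 2 + (t • z).im ^ 2) * m (t • z, s) : ℝ) : ℂ) * v (s • (t • z)) :=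
      eq_neg_of_add_eq_zero_left (h0 (t • z))
    rw [← norm_neg, ← h2] at h1
    have h3 : t * ∫ s in (0:ℝ)..1, ‖v (s • t • z)‖ = ψ t := by
      have := intervalIntegral.mul_integral_comp_mul_right (f := fun τ : ℝ => ‖v (τ • z)‖) (a := 0) (b := 1) t
      simp only [smul_smul]
      rw [this]; simp [hψ]
    calc _ ≤ _ := h1
      _ = t * ‖z‖ ^ 2 * K * (t * ∫ s in (0:ℝ)..1, ‖v (s • t • z)‖) := by rw [hn]; ring
      _ = t * (‖z‖ ^ 2 * K * ψ t) := by rw [h3]; ring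
      _ ≤ 1 * (‖z‖ ^ 2 * K * ψ t) := by
        have : 0 ≤ ψ t := intervalIntegral.integral_nonneg ht.1 fun _ _ => norm_nonneg _
        have := ht.2
        gcongr
      _ = _ := by ring
  have hg := norm_le_gronwallBound_of_norm_deriv_right_le (f := ψ) (f' := fun t => ‖v (t • z)‖)
    (δ := 0) (K := ‖z‖ ^ 2 * K) (ε := 0) (a := 0) (b := 1)
    (fun t _ => (hψd t).continuousAt.continuousWithinAt) (fun t _ => (hψd t).hasDerivWithinAt)
    (by simp [hψ]) (fun t ht => by
      have := hmain t ⟨ht.1, ht.2.le⟩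
      rw [norm_norm, add_zero]
      exact this.trans (by gcongr; exact le_abs_self _)) 1 (by simp)
  simp only [gronwallBound_ε0_δ0, norm_le_zero_iff] at hg
  have := hmain 1 (by simp)
  rw [hg] at this
  simpa using this

lemma helm_asymp (k : ℝ) {v : ℂ → ℂ} (hv : ContDiff ℝ 2 v) (hpde : ∀ z, lapC v z = -(k:ℂ) ^ 2 * v z) :
    (∀ z, v z = 0) ∨ ∃ (N : ℕ) (a b : ℂ) (δ C : ℝ), (a ≠ 0 ∨ b ≠ 0) ∧ (N = 0 → b = 0) ∧ 0 < δ ∧ 0 ≤ C ∧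
      ∀ z : ℂ, ‖z‖ ≤ δ → ‖v z - (a * z ^ N + b * conj z ^ N)‖ ≤ C * ‖z‖ ^ (N + 1) := by
  obtain ⟨m, hm, hhc, hhl⟩ := vekua (k ^ 2 / 4) hv (fun z => by rw [hpde]; push_cast; ring)
  rcases harmonic_leading hhc hhl with h0 | ⟨N, a, b, δ, C, hab, hN0, hδ, hC, hlead⟩
  · left; exact volterra_zero hv.continuous hm h0
  · right
    obtain ⟨K, hK0, hK⟩ := m_bound hm 1
    set h : ℂ → ℂ := fun z => v z + ∫ t in (0:ℝ)..1, (((z.re ^ 2 + z.im ^ 2) * m (z, t) : ℝ) : ℂ) * v (t • z) with hh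
    set δ' := min (min δ 1) (1 / (2 * (K + 1))) with hδ'
    have hδ'0 : 0 < δ' := by positivity
    have hδ1 : δ' ≤ δ := (min_le_left _ _).trans (min_le_left _ _)
    have hδ2 : δ' ≤ 1 := (min_le_left _ _).trans (min_le_right _ _)
    have hδ3 : δ' * (2 * (K + 1)) ≤ 1 := by
      have := min_le_right (min δ 1) (1 / (2 * (K + 1)))
      rw [← hδ'] at this
      rwa [le_div_iff₀ (by positivity)] at this
    have hdiff : ∀ z : ℂ, ‖z‖ ≤ δ' → ∀ M, (∀ y : ℂ, ‖y‖ ≤ ‖z‖ → ‖v y‖ ≤ M) → ‖h z - v z‖ ≤ ‖z‖ ^ 2 * K * M := by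
      intro z hz M hM
      have e : h z - v z = ∫ t in (0:ℝ)..1, (((z.re ^ 2 + z.im ^ 2) * m (z, t) : ℝ) : ℂ) * v (t • z) := by
        simp [hh]
      rw [e]
      refine (volterra_bound hv.continuous hm hK (hz.trans hδ2)).trans ?_
      gcongr
      have hcv : Continuous fun τ : ℝ => ‖v (τ • z)‖ := by have := hv.continuous; fun_prop
      have : ∫ t in (0:ℝ)..1, ‖v (t • z)‖ ≤ ∫ t in (0:ℝ)..1, M := by
        apply intervalIntegral.integral_mono_on zero_le_one (hcv.intervalIntegrable _ _) (by simp)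
        intro t ht
        apply hM
        rw [norm_smul, Real.norm_of_nonneg ht.1]
        nlinarith [norm_nonneg z, ht.2]
      simpa using this
    set C1 := ‖a‖ + ‖b‖ + C with hC1
    have hC10 : 0 ≤ C1 := by positivity
    have hhb : ∀ z : ℂ, ‖z‖ ≤ δ' → ‖h z‖ ≤ C1 * ‖z‖ ^ N := by
      intro z hz
      have h1 := hlead z (hz.trans hδ1)
      have h2 : ‖a * z ^ N + b * conj z ^ N‖ ≤ (‖a‖ + ‖b‖) * ‖z‖ ^ N := by
        refine (norm_add_le _ _).trans ?_
        simp only [norm_mul, norm_pow, RCLike.norm_conj]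
        linarith
      have h3 : ‖h z‖ ≤ ‖h z - (a * z ^ N + b * conj z ^ N)‖ + ‖a * z ^ N + b * conj z ^ N‖ := by
        simpa using norm_add_le (h z - (a * z ^ N + b * conj z ^ N)) (a * z ^ N + b * conj z ^ N)
      have h4 : ‖z‖ ^ (N + 1) ≤ ‖z‖ ^ N := by
        rw [pow_succ]
        have : 0 ≤ ‖z‖ ^ N := by positivity
        nlinarith [hz.trans hδ2]
      have h5 : C * ‖z‖ ^ (N + 1) ≤ C * ‖z‖ ^ N := by gcongr
      rw [hC1]; linarith
    have hvb : ∀ z : ℂ, ‖z‖ ≤ δ' → ‖v z‖ ≤ 2 * C1 * ‖z‖ ^ N := by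
      intro z hz
      obtain ⟨z₀, hz₀, hmax⟩ := (isCompact_closedBall (0:ℂ) ‖z‖).exists_isMaxOn ⟨0, by simp⟩
        (hv.continuous.norm.continuousOn)
      rw [mem_closedBall_zero_iff] at hz₀
      have hM : ∀ y : ℂ, ‖y‖ ≤ ‖z‖ → ‖v y‖ ≤ ‖v z₀‖ := fun y hy => hmax (by simpa using hy)
      have h1 := hdiff z₀ (hz₀.trans hz) ‖v z₀‖ (fun y hy => hM y (hy.trans hz₀))
      have h2 := hhb z₀ (hz₀.trans hz)
      have h3 : ‖v z₀‖ ≤ ‖h z₀‖ + ‖h z₀ - v z₀‖ := by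
        simpa using norm_sub_le (h z₀) (h z₀ - v z₀)
      have h4 : ‖z₀‖ ^ 2 * K ≤ 1 / 2 := by
        have hz0 := norm_nonneg z₀
        have : ‖z₀‖ ≤ δ' := hz₀.trans hz
        have : ‖z₀‖ ^ 2 ≤ δ' := by nlinarith
        nlinarith
      have h5 : ‖z₀‖ ^ N ≤ ‖z‖ ^ N := by gcongr
      have h6 : C1 * ‖z₀‖ ^ N ≤ C1 * ‖z‖ ^ N := by gcongr
      have h7 := hM z le_rfl
      nlinarith [norm_nonneg (v z₀)]
    refine ⟨N, a, b, δ', C + K * (2 * C1), hab, hN0, hδ'0, by positivity, fun z hz => ?_⟩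
    have h1 := hlead z (hz.trans hδ1)
    have h2 := hdiff z hz (2 * C1 * ‖z‖ ^ N) (fun y hy => (hvb y (hy.trans hz)).trans (by gcongr))
    have h3 : ‖v z - (a * z ^ N + b * conj z ^ N)‖ ≤ ‖h z - (a * z ^ N + b * conj z ^ N)‖ + ‖h z - v z‖ := by
      have := norm_sub_le (h z - (a * z ^ N + b * conj z ^ N)) (h z - v z)
      rwa [show h z - (a * z ^ N + b * conj z ^ N) - (h z - v z) = v z - (a * z ^ N + b * conj z ^ N) by ring] at this
    have h4 : ‖z‖ ^ 2 * K * (2 * C1 * ‖z‖ ^ N) ≤ K * (2 * C1) * ‖z‖ ^ (N + 1) := by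
      have : ‖z‖ ^ 2 * K * (2 * C1 * ‖z‖ ^ N) = K * (2 * C1) * ‖z‖ ^ (N + 1) * ‖z‖ := by ring
      rw [this]
      have : 0 ≤ K * (2 * C1) * ‖z‖ ^ (N + 1) := by positivity
      nlinarith [hz.trans hδ2]
    linarith

end CornerAux

namespace CornerAux
open Filter Topology
open scoped ComplexConjugate

section cs
variable {E : Type*} [NormedAddCommGroup E] [NormedSpace ℝ E]

lemma cs_dX {f : ℂ → E} (h : HasCompactSupport f) : HasCompactSupport (dX f) := h.fderiv_apply ℝ 1
lemma cs_dY {f : ℂ → E} (h : HasCompactSupport f) : HasCompactSupport (dY f) :=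
  h.fderiv_apply ℝ Complex.I
lemma cs_lap {f : ℂ → E} (h : HasCompactSupport f) : HasCompactSupport (lapC f) :=
  (cs_dX (cs_dX h)).add (cs_dY (cs_dY h))
end cs

lemma int_fderiv {K : Type*} [RCLike K] {f : ℂ → K} (hf : ContDiff ℝ 1 f) (hc : HasCompactSupport f) (v : ℂ) :
    ∫ z, fderiv ℝ f z v = 0 := by
  have h1 : Continuous fun z => fderiv ℝ f z v :=
    ((hf.continuous_fderiv (by norm_num)).clm_apply continuous_const)
  have h := integral_mul_fderiv_eq_neg_fderiv_mul_of_integrable (μ := (volume : Measure ℂ)) (f := fun _ : ℂ => (1:K)) (g := f) (v := v)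
    (by simp) (by simpa using h1.integrable_of_hasCompactSupport (hc.fderiv_apply ℝ v))
    (by simpa using hf.continuous.integrable_of_hasCompactSupport hc)
    (fun x _ => by fun_prop) (fun x _ => hf.differentiable (by norm_num) x)
  simpa using h

lemma int_dX {K : Type*} [RCLike K] {f : ℂ → K} (hf : ContDiff ℝ 1 f) (hc : HasCompactSupport f) :
    ∫ z, dX f z = 0 := int_fderiv hf hc 1
lemma int_dY {K : Type*} [RCLike K] {f : ℂ → K} (hf : ContDiff ℝ 1 f) (hc : HasCompactSupport f) :
    ∫ z, dY f z = 0 := int_fderiv hf hc Complex.I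

lemma C2.one {E : Type*} [NormedAddCommGroup E] [NormedSpace ℝ E] {f : ℂ → E} (hf : ContDiff ℝ 2 f) :
    ContDiff ℝ 1 f := hf.of_le (by norm_num)

lemma int_of_cc {E : Type*} [NormedAddCommGroup E] {f : ℂ → E} (hf : Continuous f) (hc : HasCompactSupport f) :
    Integrable f := hf.integrable_of_hasCompactSupport hc

lemma green {f g : ℂ → ℂ} (hf : ContDiff ℝ 2 f) (hc : HasCompactSupport f) (hg : ContDiff ℝ 2 g)
    (hl : ∀ z, lapC g z = 0) : ∫ z, lapC f z * g z = 0 := by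
  have a1 := int_dX (f := fun z => dX f z * g z - f z * dX g z)
    (((C2.dX1 hf).mul (C2.one hg)).sub ((C2.one hf).mul (C2.dX1 hg)))
    (((cs_dX hc).mul_right).sub hc.mul_right)
  have a2 := int_dY (f := fun z => dY f z * g z - f z * dY g z)
    (((C2.dY1 hf).mul (C2.one hg)).sub ((C2.one hf).mul (C2.dY1 hg)))
    (((cs_dY hc).mul_right).sub hc.mul_right)
  have e1 : ∀ z, dX (fun z => dX f z * g z - f z * dX g z) z = dX (dX f) z * g z - f z * dX (dX g) z := by
    intro z
    rw [dX_sub ((C2.dXd hf z).fun_mul (C2.d hg z)) ((C2.d hf z).fun_mul (C2.dXd hg z)),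
      dX_mul (C2.dXd hf z) (C2.d hg z), dX_mul (C2.d hf z) (C2.dXd hg z)]
    ring
  have e2 : ∀ z, dY (fun z => dY f z * g z - f z * dY g z) z = dY (dY f) z * g z - f z * dY (dY g) z := by
    intro z
    rw [dY_sub ((C2.dYd hf z).fun_mul (C2.d hg z)) ((C2.d hf z).fun_mul (C2.dYd hg z)),
      dY_mul (C2.dYd hf z) (C2.d hg z), dY_mul (C2.d hf z) (C2.dYd hg z)]
    ring
  simp only [e1] at a1
  simp only [e2] at a2
  have c0 := C2.d hf |>.continuous
  have c1 := C2.d hg |>.continuous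
  have c2 := C1.dXc (C2.dX1 hf)
  have c3 := C1.dYc (C2.dY1 hf)
  have c4 := C1.dXc (C2.dX1 hg)
  have c5 := C1.dYc (C2.dY1 hg)
  have i1 : Integrable fun z => dX (dX f) z * g z - f z * dX (dX g) z :=
    int_of_cc (by fun_prop) (HasCompactSupport.sub (cs_dX (cs_dX hc)).mul_right hc.mul_right)
  have i2 : Integrable fun z => dY (dY f) z * g z - f z * dY (dY g) z :=
    int_of_cc (by fun_prop) (HasCompactSupport.sub (cs_dY (cs_dY hc)).mul_right hc.mul_right)
  have a3 := integral_add i1 i2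
  rw [a1, a2, add_zero] at a3
  rw [← a3]
  refine integral_congr_ae (Eventually.of_forall fun z => ?_)
  have := hl z
  unfold lapC at this
  simp only [lapC]
  linear_combination f z * this

lemma carl_V {V : ℂ → ℝ} (hV : ContDiff ℝ 2 V) (hc : HasCompactSupport V) (s : ℝ) :
    ∫ z, (lapC V z + 2 * s * dX V z + s ^ 2 * V z) * dX V z = 2 * s * ∫ z, dX V z ^ 2 := by
  have a1 := int_dX (f := fun z => (dX V z * dX V z - dY V z * dY V z + V z * V z * s ^ 2) * (1/2))
    (((((C2.dX1 hV).mul (C2.dX1 hV)).sub ((C2.dY1 hV).mul (C2.dY1 hV))).add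
      (((C2.one hV).mul (C2.one hV)).mul contDiff_const)).mul contDiff_const)
    (((((cs_dX hc).mul_right).sub (cs_dY hc).mul_right).add hc.mul_right.mul_right).mul_right)
  have a2 := int_dY (f := fun z => dX V z * dY V z) ((C2.dX1 hV).mul (C2.dY1 hV)) (cs_dX hc).mul_right
  have e1 : ∀ z, dX (fun z => (dX V z * dX V z - dY V z * dY V z + V z * V z * s ^ 2) * (1/2)) z
      = dX V z * dX (dX V) z - dY V z * dX (dY V) z + s ^ 2 * (V z * dX V z) := by
    intro z
    have d0 := C2.d hV z
    have d1 := C2.dXd hV z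
    have d2 := C2.dYd hV z
    have hcst : ∀ c : ℝ, dX (fun _ : ℂ => c) z = 0 := by intro c; unfold dX; simp
    rw [dX_mul (by fun_prop) (by fun_prop), dX_add (by fun_prop) (by fun_prop),
      dX_sub (by fun_prop) (by fun_prop), dX_mul d1 d1, dX_mul d2 d2, dX_mul (by fun_prop) (by fun_prop),
      dX_mul d0 d0, hcst, hcst]
    ring
  have e2 : ∀ z, dY (fun z => dX V z * dY V z) z = dX V z * dY (dY V) z + dY (dX V) z * dY V z :=
    fun z => dY_mul (C2.dXd hV z) (C2.dYd hV z)
  simp only [e1] at a1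
  simp only [e2] at a2
  have c0 := C2.d hV |>.continuous
  have c1 := C2.dXd hV |>.continuous
  have c1' := C2.dYd hV |>.continuous
  have c2 := C1.dXc (C2.dX1 hV)
  have c3 := C1.dYc (C2.dY1 hV)
  have c4 := C1.dXc (C2.dY1 hV)
  have c5 := C1.dYc (C2.dX1 hV)
  have key : ∀ z, (lapC V z + 2 * s * dX V z + s ^ 2 * V z) * dX V z =
      ((dX V z * dX (dX V) z - dY V z * dX (dY V) z + s ^ 2 * (V z * dX V z)) +
      (dX V z * dY (dY V) z + dY (dX V) z * dY V z)) + 2 * s * dX V z ^ 2 := by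
    intro z
    rw [dXY_symm hV]
    unfold lapC; ring
  simp only [key]
  have i1 : Integrable fun z => dX V z * dX (dX V) z - dY V z * dX (dY V) z + s ^ 2 * (V z * dX V z) :=
    int_of_cc (by fun_prop) (((cs_dX hc).mul_right.sub (cs_dY hc).mul_right).add hc.mul_right.mul_left)
  have i2 : Integrable fun z => dX V z * dY (dY V) z + dY (dX V) z * dY V z :=
    int_of_cc (by fun_prop) ((cs_dX hc).mul_right.add (cs_dY hc).mul_left)
  have i3 : Integrable fun z => 2 * s * dX V z ^ 2 := by
    simp only [pow_two]
    exact int_of_cc (by fun_prop) ((cs_dX hc).mul_right.mul_left)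
  rw [integral_add (by exact i1.add i2) i3, integral_add i1 i2, a1, a2, integral_const_mul]
  ring

lemma carl_V2 {V : ℂ → ℝ} (hV : ContDiff ℝ 2 V) (hc : HasCompactSupport V) {s R : ℝ} (hs : 0 < s)
    (hsupp : ∀ z, V z ≠ 0 → |z.re| ≤ R) :
    ∫ z, V z ^ 2 ≤ R ^ 2 / s ^ 2 * ∫ z, (lapC V z + 2 * s * dX V z + s ^ 2 * V z) ^ 2 := by
  have c0 := C2.d hV |>.continuous
  have c1 := C2.dXd hV |>.continuous
  have c2 := C2.lapc hV
  set F := fun z => lapC V z + 2 * s * dX V z + s ^ 2 * V z with hF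
  have cF : Continuous F := by simp only [hF]; fun_prop
  have sF : HasCompactSupport F := ((cs_lap hc).add (cs_dX hc).mul_left).add hc.mul_left
  have iF : Integrable fun z => F z ^ 2 := by
    simp only [pow_two]; exact int_of_cc (by fun_prop) sF.mul_right
  have iD : Integrable fun z => dX V z ^ 2 := by
    simp only [pow_two]; exact int_of_cc (by fun_prop) (cs_dX hc).mul_right
  have iV : Integrable fun z => V z ^ 2 := by
    simp only [pow_two]; exact int_of_cc (by fun_prop) hc.mul_right
  have iFD : Integrable fun z => F z * dX V z := int_of_cc (by fun_prop) sF.mul_right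
  have h1 := carl_V hV hc s
  have h2 : ∫ z, F z * dX V z ≤ ∫ z, (s * dX V z ^ 2 + (1 / (4 * s)) * F z ^ 2) := by
    apply integral_mono iFD (by exact (iD.const_mul _).add (iF.const_mul _))
    intro z
    have : s * dX V z ^ 2 + (1 / (4 * s)) * F z ^ 2 - F z * dX V z = (1 / s) * (s * dX V z - F z / 2) ^ 2 := by
      field_simp; ring
    have h : 0 ≤ (1 / s) * (s * dX V z - F z / 2) ^ 2 := by positivity
    simp only
    linarith
  rw [integral_add (iD.const_mul _) (iF.const_mul _), integral_const_mul, integral_const_mul] at h2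
  change ∫ z, F z * dX V z = _ at h1
  rw [h1] at h2
  have h3 : ∫ z, dX V z ^ 2 ≤ 1 / (4 * s ^ 2) * ∫ z, F z ^ 2 := by
    have : s * ∫ z, dX V z ^ 2 ≤ s * (1 / (4 * s ^ 2) * ∫ z, F z ^ 2) := by
      have e : s * (1 / (4 * s ^ 2) * ∫ z, F z ^ 2) = 1 / (4 * s) * ∫ z, F z ^ 2 := by field_simp
      rw [e]; linarith
    exact le_of_mul_le_mul_left this hs
  -- Poincare
  have a1 := int_dX (f := fun z : ℂ => z.re * (V z * V z))
    ((Complex.reCLM.contDiff).mul ((C2.one hV).mul (C2.one hV))) (hc.mul_right.mul_left)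
  have e1 : ∀ z, dX (fun z : ℂ => z.re * (V z * V z)) z = V z ^ 2 + 2 * (z.re * V z * dX V z) := by
    intro z
    have d0 := C2.d hV z
    rw [dX_mul (hasFDerivAt_re z).differentiableAt (d0.fun_mul d0), dX_mul d0 d0, dX_eq_of (hasFDerivAt_re z)]
    simp; ring
  simp only [e1] at a1
  have iM : Integrable fun z : ℂ => z.re * V z * dX V z := int_of_cc (by fun_prop) hc.mul_left.mul_right
  rw [integral_add iV (iM.const_mul _), integral_const_mul] at a1
  have h4 : -(∫ z : ℂ, z.re * V z * dX V z) ≤ ∫ z, ((1/4) * V z ^ 2 + R ^ 2 * dX V z ^ 2) := by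
    rw [← integral_neg]
    apply integral_mono (by exact iM.neg) (by exact (iV.const_mul _).add (iD.const_mul _))
    intro z
    simp only
    by_cases hz : V z = 0
    · simp [hz]; positivity
    · have hR := hsupp z hz
      have hR2 : z.re ^ 2 ≤ R ^ 2 := sq_le_sq' (by linarith [abs_le.1 hR]) (abs_le.1 hR).2
      nlinarith [sq_nonneg (V z / 2 + z.re * dX V z), mul_le_mul_of_nonneg_right hR2 (sq_nonneg (dX V z))]
  rw [integral_add (iV.const_mul _) (iD.const_mul _), integral_const_mul, integral_const_mul] at h4
  have h5 : ∫ z, V z ^ 2 ≤ 4 * R ^ 2 * ∫ z, dX V z ^ 2 := by linarith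
  calc _ ≤ 4 * R ^ 2 * ∫ z, dX V z ^ 2 := h5
    _ ≤ 4 * R ^ 2 * (1 / (4 * s ^ 2) * ∫ z, F z ^ 2) := by gcongr
    _ = R ^ 2 / s ^ 2 * ∫ z, F z ^ 2 := by field_simp

lemma hasFDerivAt_expre (s : ℝ) (z : ℂ) : HasFDerivAt (fun z : ℂ => Real.exp (-s * z.re))
    ((-s * Real.exp (-s * z.re)) • Complex.reCLM) z := by
  have h := ((hasFDerivAt_re z).const_mul (-s)).exp
  refine h.congr_fderiv ?_
  rw [smul_smul]; congr 1; ring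

lemma contDiff_expre (s : ℝ) : ContDiff ℝ 2 (fun z : ℂ => Real.exp (-s * z.re)) :=
  (contDiff_const.mul Complex.reCLM.contDiff).exp

lemma dX_expre (s : ℝ) (z : ℂ) : dX (fun z : ℂ => Real.exp (-s * z.re)) z = -s * Real.exp (-s * z.re) := by
  rw [dX_eq_of (hasFDerivAt_expre s z)]; simp

lemma dY_expre (s : ℝ) (z : ℂ) : dY (fun z : ℂ => Real.exp (-s * z.re)) z = 0 := by
  rw [dY_eq_of (hasFDerivAt_expre s z)]; simp

lemma lapC_expre (s : ℝ) (z : ℂ) :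
    lapC (fun z : ℂ => Real.exp (-s * z.re)) z = s ^ 2 * Real.exp (-s * z.re) := by
  have e1 : dX (fun z : ℂ => Real.exp (-s * z.re)) = fun z => -s * Real.exp (-s * z.re) := by
    ext z; exact dX_expre s z
  have e2 : dY (fun z : ℂ => Real.exp (-s * z.re)) = fun z => 0 := by
    ext z; exact dY_expre s z
  unfold lapC
  rw [e1, e2, dX_eq_of ((hasFDerivAt_expre s z).const_mul (-s))]
  simp [dY]; ring

lemma carl_real {w : ℂ → ℝ} (hw : ContDiff ℝ 2 w) (hc : HasCompactSupport w) {s R : ℝ} (hs : 0 < s)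
    (hsupp : ∀ z, w z ≠ 0 → |z.re| ≤ R) :
    ∫ z : ℂ, Real.exp (-2 * s * z.re) * w z ^ 2 ≤
      R ^ 2 / s ^ 2 * ∫ z : ℂ, Real.exp (-2 * s * z.re) * lapC w z ^ 2 := by
  have h := carl_V2 (V := fun z => Real.exp (-s * z.re) * w z) ((contDiff_expre s).mul hw) hc.mul_left hs
    (fun z hz => hsupp z (right_ne_zero_of_mul hz))
  have ee : ∀ x : ℝ, Real.exp (-2 * s * x) = Real.exp (-s * x) ^ 2 := by
    intro x; rw [← Real.exp_nat_mul]; congr 1; push_cast; ring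
  convert h using 3 with z
  · rw [ee]; ring
  · ext z
    rw [lapC_mul (contDiff_expre s) hw, dX_mul (C2.d (contDiff_expre s) z) (C2.d hw z), lapC_expre, dX_expre, dY_expre, ee]
    ring

section reim
lemma dX_clm {f : ℂ → ℂ} (L : ℂ →L[ℝ] ℝ) {z : ℂ} (hf : DifferentiableAt ℝ f z) :
    dX (fun z => L (f z)) z = L (dX f z) := by
  exact dX_eq_of (L.hasFDerivAt.comp z hf.hasFDerivAt)
lemma dY_clm {f : ℂ → ℂ} (L : ℂ →L[ℝ] ℝ) {z : ℂ} (hf : DifferentiableAt ℝ f z) :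
    dY (fun z => L (f z)) z = L (dY f z) := by
  exact dY_eq_of (L.hasFDerivAt.comp z hf.hasFDerivAt)
lemma lapC_clm {f : ℂ → ℂ} (L : ℂ →L[ℝ] ℝ) (hf : ContDiff ℝ 2 f) (z : ℂ) :
    lapC (fun z => L (f z)) z = L (lapC f z) := by
  have e1 : dX (fun z => L (f z)) = fun z => L (dX f z) := by ext z; exact dX_clm L (C2.d hf z)
  have e2 : dY (fun z => L (f z)) = fun z => L (dY f z) := by ext z; exact dY_clm L (C2.d hf z)
  unfold lapC
  rw [e1, e2, dX_clm L (C2.dXd hf z), dY_clm L (C2.dYd hf z), map_add]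
end reim

lemma carleman {f : ℂ → ℂ} (hf : ContDiff ℝ 2 f) (hc : HasCompactSupport f) {s R : ℝ} (hs : 0 < s)
    (hsupp : ∀ z, f z ≠ 0 → |z.re| ≤ R) :
    ∫ z : ℂ, Real.exp (-2 * s * z.re) * ‖f z‖ ^ 2 ≤
      R ^ 2 / s ^ 2 * ∫ z : ℂ, Real.exp (-2 * s * z.re) * ‖lapC f z‖ ^ 2 := by
  have main : ∀ L : ℂ →L[ℝ] ℝ, ∫ z : ℂ, Real.exp (-2 * s * z.re) * (L (f z)) ^ 2 ≤
      R ^ 2 / s ^ 2 * ∫ z : ℂ, Real.exp (-2 * s * z.re) * (L (lapC f z)) ^ 2 := by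
    intro L
    have h := carl_real (w := fun z => L (f z)) (L.contDiff.comp hf) (hc.comp_left (g := L) (map_zero _)) hs
      (R := R) (fun z hz => hsupp z (by intro h0; simp [h0] at hz))
    simpa only [lapC_clm L hf] using h
  have c0 := C2.d hf |>.continuous
  have c2 := C2.lapc hf
  have hintg : ∀ (L : ℂ →L[ℝ] ℝ) (g : ℂ → ℂ), Continuous g → HasCompactSupport g →
      Integrable fun z : ℂ => Real.exp (-2 * s * z.re) * (L (g z)) ^ 2 := by
    intro L g hg hgc
    simp only [pow_two]
    exact int_of_cc (by fun_prop) ((hgc.comp_left (g := L) (map_zero _)).mul_right.mul_left)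
  have m1 := main Complex.reCLM
  have m2 := main Complex.imCLM
  have split : ∀ g : ℂ → ℂ, Continuous g → HasCompactSupport g →
      ∫ z : ℂ, Real.exp (-2 * s * z.re) * ‖g z‖ ^ 2 =
      (∫ z : ℂ, Real.exp (-2 * s * z.re) * (Complex.reCLM (g z)) ^ 2) +
      ∫ z : ℂ, Real.exp (-2 * s * z.re) * (Complex.imCLM (g z)) ^ 2 := by
    intro g hg hgc
    rw [← integral_add (hintg _ g hg hgc) (hintg _ g hg hgc)]
    congr 1; ext z
    rw [← sq_eq_norm]; simp; ring
  rw [split f c0 hc, split _ c2 (cs_lap hc), mul_add]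
  exact add_le_add m1 m2

lemma green_exp {f : ℂ → ℂ} (hf : ContDiff ℝ 2 f) (hc : HasCompactSupport f) (s : ℝ) :
    ∫ z, lapC f z * Complex.exp (-s * z) = 0 := by
  have hd : ∀ z : ℂ, HasFDerivAt (fun z : ℂ => Complex.exp (-s * z))
      ((-s * Complex.exp (-s * z)) • (ContinuousLinearMap.id ℝ ℂ)) z := by
    intro z
    have h := ((hasFDerivAt_id (𝕜 := ℝ) z).const_mul (-s : ℂ)).cexp
    refine h.congr_fderiv ?_
    rw [smul_smul]; congr 1; simp; ring
  refine green hf hc (by fun_prop) ?_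
  intro z
  have e1 : dX (fun z : ℂ => Complex.exp (-s * z)) = fun z => -s * Complex.exp (-s * z) := by
    ext z; rw [dX_eq_of (hd z)]; simp
  have e2 : dY (fun z : ℂ => Complex.exp (-s * z)) = fun z => (-s * Complex.I) * Complex.exp (-s * z) := by
    ext z; rw [dY_eq_of (hd z)]; simp; ring
  unfold lapC
  rw [e1, e2, dX_eq_of ((hd z).const_mul _), dY_eq_of ((hd z).const_mul _)]
  simp only [ContinuousLinearMap.smul_apply, smul_eq_mul, ContinuousLinearMap.id_apply, ContinuousLinearEquiv.coe_coe, Complex.conjCLE_apply, map_one, Complex.conj_I]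
  linear_combination s ^ 2 * Complex.exp (-s * z) * Complex.I_mul_I

lemma green_exp_conj {f : ℂ → ℂ} (hf : ContDiff ℝ 2 f) (hc : HasCompactSupport f) (s : ℝ) :
    ∫ z, lapC f z * Complex.exp (-s * conj z) = 0 := by
  have hd : ∀ z : ℂ, HasFDerivAt (fun z : ℂ => Complex.exp (-s * conj z))
      ((-s * Complex.exp (-s * conj z)) • (Complex.conjCLE : ℂ →L[ℝ] ℂ)) z := by
    intro z
    have h := (((Complex.conjCLE : ℂ →L[ℝ] ℂ).hasFDerivAt (x := z)).const_mul (-s : ℂ)).cexp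
    refine h.congr_fderiv ?_
    rw [smul_smul]; congr 1; simp; ring
  have hcd : ContDiff ℝ 2 (fun z : ℂ => Complex.exp (-s * conj z)) :=
    (contDiff_const.mul (Complex.conjCLE : ℂ →L[ℝ] ℂ).contDiff).cexp
  refine green hf hc hcd ?_
  intro z
  have e1 : dX (fun z : ℂ => Complex.exp (-s * conj z)) = fun z => -s * Complex.exp (-s * conj z) := by
    ext z; rw [dX_eq_of (hd z)]; simp
  have e2 : dY (fun z : ℂ => Complex.exp (-s * conj z)) = fun z => (s * Complex.I) * Complex.exp (-s * conj z) := by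
    ext z; rw [dY_eq_of (hd z)]; simp; ring
  unfold lapC
  rw [e1, e2, dX_eq_of ((hd z).const_mul _), dY_eq_of ((hd z).const_mul _)]
  simp only [ContinuousLinearMap.smul_apply, smul_eq_mul, ContinuousLinearMap.id_apply, ContinuousLinearEquiv.coe_coe, Complex.conjCLE_apply, map_one, Complex.conj_I]
  linear_combination s ^ 2 * Complex.exp (-s * conj z) * Complex.I_mul_I

end CornerAux

namespace CornerAux
open Filter Topology
open scoped ComplexConjugate
open scoped Pointwise

def sector (φ : ℝ) : Set ℂ := {z | |z.im| ≤ Real.tan φ * z.re}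

lemma sector_closed (φ : ℝ) : IsClosed (sector φ) := by
  unfold sector
  exact isClosed_le (by fun_prop) (by fun_prop)

lemma sector_meas (φ : ℝ) : MeasurableSet (sector φ) := (sector_closed φ).measurableSet

lemma sector_re {φ : ℝ} (h0 : 0 < φ) (h1 : φ < π / 2) {z : ℂ} (hz : z ∈ sector φ) : 0 ≤ z.re := by
  have ht := Real.tan_pos_of_pos_of_lt_pi_div_two h0 h1
  have := (abs_nonneg _).trans (show |z.im| ≤ Real.tan φ * z.re from hz)
  exact nonneg_of_mul_nonneg_right this ht

lemma sector_norm {φ : ℝ} (h0 : 0 < φ) (h1 : φ < π / 2) {z : ℂ} (hz : z ∈ sector φ) :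
    Real.cos φ * ‖z‖ ≤ z.re := by
  have hc : 0 < Real.cos φ := Real.cos_pos_of_mem_Ioo ⟨by linarith, h1⟩
  have hr := sector_re h0 h1 hz
  have hz' : |z.im| ≤ Real.tan φ * z.re := hz
  apply le_of_sq_le_sq _ hr
  rw [mul_pow, ← sq_eq_norm]
  have h2 : z.im ^ 2 ≤ (Real.tan φ * z.re) ^ 2 := by
    rw [← sq_abs]; gcongr
  have h3 : Real.cos φ * Real.tan φ = Real.sin φ := by rw [mul_comm]; exact Real.tan_mul_cos hc.ne'
  calc Real.cos φ ^ 2 * (z.re ^ 2 + z.im ^ 2) ≤ Real.cos φ ^ 2 * (z.re ^ 2 + (Real.tan φ * z.re) ^ 2) := by gcongr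
    _ = (Real.cos φ ^ 2 + (Real.cos φ * Real.tan φ) ^ 2) * z.re ^ 2 := by ring
    _ = z.re ^ 2 := by rw [h3, Real.cos_sq_add_sin_sq, one_mul]

lemma sector_smul {φ : ℝ} {s : ℝ} (hs : 0 < s) : s • sector φ = sector φ := by
  ext z
  rw [mem_smul_set_iff_inv_smul_mem₀ hs.ne']
  simp only [sector, mem_setOf_eq, Complex.smul_re, Complex.smul_im, smul_eq_mul, abs_mul]
  rw [abs_of_pos (inv_pos.2 hs), ← mul_assoc, mul_comm (Real.tan φ), mul_assoc]
  exact mul_le_mul_iff_right₀ (inv_pos.2 hs)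

lemma sector_scale {φ : ℝ} {E : Type*} [NormedAddCommGroup E] [NormedSpace ℝ E] (G : ℂ → E) {s : ℝ} (hs : 0 < s) :
    ∫ z in sector φ, G (s • z) = (s ^ 2)⁻¹ • ∫ z in sector φ, G z := by
  rw [Measure.setIntegral_comp_smul_of_pos volume G (sector φ) hs, sector_smul hs, Complex.finrank_real_complex]

lemma int_norm_exp (m : ℕ) {c : ℝ} (hc : 0 < c) : Integrable fun z : ℂ => ‖z‖ ^ m * Real.exp (-c * ‖z‖) := by
  rw [integrable_fun_norm_addHaar (volume : Measure ℂ) (f := fun y => y ^ m * Real.exp (-c * y))]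
  rw [Complex.finrank_real_complex]
  have h := integrableOn_rpow_mul_exp_neg_mul_rpow (s := m + 1) (p := 1) (b := c) (by linarith [Nat.cast_nonneg (α := ℝ) m]) one_pos hc
  refine h.congr_fun (fun y hy => ?_) measurableSet_Ioi
  simp only [Real.rpow_one, smul_eq_mul]
  have : y ^ ((m:ℝ) + 1) = y ^ (m + 1) := by rw [← Real.rpow_natCast]; push_cast; rfl
  rw [this]; ring_nf

lemma int_weight {φ : ℝ} (h0 : 0 < φ) (h1 : φ < π / 2) (m : ℕ) {s : ℝ} (hs : 0 < s) :
    IntegrableOn (fun z : ℂ => ‖z‖ ^ m * Real.exp (-s * z.re)) (sector φ) := by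
  have hc : 0 < Real.cos φ := Real.cos_pos_of_mem_Ioo ⟨by linarith, h1⟩
  refine Integrable.mono' ((int_norm_exp m (mul_pos hs hc)).integrableOn) (by
    apply Continuous.aestronglyMeasurable; fun_prop) ?_
  filter_upwards [ae_restrict_mem (sector_meas φ)] with z hz
  rw [Real.norm_of_nonneg (by positivity)]
  apply mul_le_mul_of_nonneg_left _ (by positivity)
  apply Real.exp_le_exp.2
  have := mul_le_mul_of_nonneg_left (sector_norm h0 h1 hz) hs.le
  linarith

noncomputable def Jm (φ : ℝ) (m : ℕ) : ℝ := ∫ z in sector φ, ‖z‖ ^ m * Real.exp (-z.re)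

lemma Jm_nonneg (φ : ℝ) (m : ℕ) : 0 ≤ Jm φ m := by
  unfold Jm; apply integral_nonneg; intro z; positivity

lemma weight_eq {φ : ℝ} (m : ℕ) {s : ℝ} (hs : 0 < s) :
    ∫ z in sector φ, ‖z‖ ^ m * Real.exp (-s * z.re) = Jm φ m / s ^ (m + 2) := by
  have h := sector_scale (φ := φ) (fun z : ℂ => ‖z‖ ^ m * Real.exp (-z.re)) hs
  simp only [norm_smul, Complex.smul_re, smul_eq_mul, Real.norm_of_nonneg hs.le, mul_pow] at h
  have e : ∀ z : ℂ, s ^ m * ‖z‖ ^ m * Real.exp (-(s * z.re)) = s ^ m * (‖z‖ ^ m * Real.exp (-s * z.re)) := by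
    intro z; rw [neg_mul]; ring
  simp only [e] at h
  rw [integral_const_mul] at h
  change _ = (s ^ 2)⁻¹ * Jm φ m at h
  field_simp at h ⊢
  rw [pow_add]; linarith

end CornerAux

namespace CornerAux
open Filter Topology
open scoped ComplexConjugate

lemma cc_exp_int {g : ℂ → ℝ} (hg : Continuous g) (hgc : HasCompactSupport g) (s : ℝ) :
    Integrable fun z : ℂ => Real.exp (-s * z.re) * g z :=
  int_of_cc (by fun_prop) hgc.mul_left

lemma cs_normsq {g : ℂ → ℂ} (hgc : HasCompactSupport g) : HasCompactSupport fun z => ‖g z‖ ^ 2 :=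
  hgc.comp_left (g := fun w : ℂ => ‖w‖ ^ 2) (by simp)

lemma L2_bound {φ : ℝ} (h0 : 0 < φ) (h1 : φ < π / 2) {f : ℂ → ℂ} (hf : ContDiff ℝ 2 f)
    (hc : HasCompactSupport f) {R K C : ℝ} (hR : 0 ≤ R) (hK : 0 ≤ K)
    (hsupp : ∀ z, f z ≠ 0 → |z.re| ≤ R) (N : ℕ)
    (H0 : ∀ z, z ∉ sector φ → lapC f z = 0)
    (H1 : ∀ z ∈ sector φ, ‖lapC f z‖ ≤ K * ‖f z‖ + C * ‖z‖ ^ N) :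
    ∃ B s0 : ℝ, 0 ≤ B ∧ 0 < s0 ∧ ∀ s, s0 ≤ s →
      ∫ z : ℂ, Real.exp (-s * z.re) * ‖f z‖ ^ 2 ≤ B / s ^ (2 * N + 4) := by
  refine ⟨16 * R ^ 2 * C ^ 2 * Jm φ (2 * N), 4 * R * K + 1, by have := Jm_nonneg φ (2*N); positivity, by positivity, ?_⟩
  intro s hs
  have hs0 : 0 < s := lt_of_lt_of_le (by positivity) hs
  have c0 := C2.d hf |>.continuous
  have c2 := C2.lapc hf
  have h := carleman hf hc (half_pos hs0) hsupp
  have es : -2 * (s / 2) = -s := by ring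
  rw [es] at h
  set I := ∫ z : ℂ, Real.exp (-s * z.re) * ‖f z‖ ^ 2 with hI
  have hI0 : 0 ≤ I := integral_nonneg fun z => by positivity
  have iL : Integrable fun z : ℂ => Real.exp (-s * z.re) * ‖lapC f z‖ ^ 2 :=
    cc_exp_int (by fun_prop) (cs_normsq (cs_lap hc)) s
  have iF : Integrable fun z : ℂ => Real.exp (-s * z.re) * ‖f z‖ ^ 2 :=
    cc_exp_int (by fun_prop) (cs_normsq hc) s
  have e1 : ∫ z : ℂ, Real.exp (-s * z.re) * ‖lapC f z‖ ^ 2 =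
      ∫ z in sector φ, Real.exp (-s * z.re) * ‖lapC f z‖ ^ 2 := by
    rw [setIntegral_eq_integral_of_forall_compl_eq_zero]
    intro z hz; simp [H0 z hz]
  have iw := int_weight h0 h1 (2 * N) hs0
  have e2 : ∫ z in sector φ, Real.exp (-s * z.re) * ‖lapC f z‖ ^ 2 ≤
      ∫ z in sector φ, (2 * K ^ 2 * (Real.exp (-s * z.re) * ‖f z‖ ^ 2) +
        2 * C ^ 2 * (‖z‖ ^ (2 * N) * Real.exp (-s * z.re))) := by
    apply setIntegral_mono_on iL.integrableOn
      (by exact (iF.integrableOn.const_mul _).add (iw.const_mul _)) (sector_meas φ)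
    intro z hz
    have hb := H1 z hz
    have hsq : ‖lapC f z‖ ^ 2 ≤ 2 * K ^ 2 * ‖f z‖ ^ 2 + 2 * C ^ 2 * ‖z‖ ^ (2 * N) := by
      have : ‖lapC f z‖ ^ 2 ≤ (K * ‖f z‖ + C * ‖z‖ ^ N) ^ 2 := by gcongr
      rw [mul_comm 2 N, pow_mul]
      nlinarith [sq_nonneg (K * ‖f z‖ - C * ‖z‖ ^ N)]
    have := mul_le_mul_of_nonneg_left hsq (Real.exp_pos (-s * z.re)).le
    nlinarith
  rw [integral_add (iF.integrableOn.const_mul _) (iw.const_mul _), integral_const_mul,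
    integral_const_mul, weight_eq _ hs0] at e2
  have e3 : ∫ z in sector φ, Real.exp (-s * z.re) * ‖f z‖ ^ 2 ≤ I :=
    setIntegral_le_integral iF (Eventually.of_forall fun z => by positivity)
  rw [e1] at h
  have h5 : I ≤ R ^ 2 / (s / 2) ^ 2 * (2 * K ^ 2 * I + 2 * C ^ 2 * (Jm φ (2 * N) / s ^ (2 * N + 2))) := by
    refine h.trans ?_
    gcongr
    refine e2.trans ?_
    gcongr
  have hK1 : R ^ 2 / (s / 2) ^ 2 * (2 * K ^ 2) ≤ 1 / 2 := by
    rw [div_mul_eq_mul_div, div_le_iff₀ (by positivity)]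
    have : (4 * R * K) ^ 2 ≤ s ^ 2 := by
      have : 4 * R * K ≤ s := by linarith
      gcongr
    nlinarith
  have h6 : I ≤ 2 * (R ^ 2 / (s / 2) ^ 2 * (2 * C ^ 2 * (Jm φ (2 * N) / s ^ (2 * N + 2)))) := by
    have := mul_le_mul_of_nonneg_right hK1 hI0
    nlinarith
  refine h6.trans (le_of_eq ?_)
  rw [show 2 * N + 4 = 2 * N + 2 + 2 by ring, pow_add s (2 * N + 2) 2]
  field_simp
  ring

lemma L1_bound {φ : ℝ} (h0 : 0 < φ) (h1 : φ < π / 2) {f : ℂ → ℂ} (hf : Continuous f)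
    (hc : HasCompactSupport f) (N : ℕ) {B s : ℝ} (hs : 0 < s)
    (h : ∫ z : ℂ, Real.exp (-s * z.re) * ‖f z‖ ^ 2 ≤ B / s ^ (2 * N + 4)) :
    ∫ z in sector φ, ‖f z‖ * Real.exp (-s * z.re) ≤ ((B + Jm φ 0) / 2) / s ^ (N + 3) := by
  have iF : Integrable fun z : ℂ => Real.exp (-s * z.re) * ‖f z‖ ^ 2 :=
    cc_exp_int (by fun_prop) (cs_normsq hc) s
  have iA : Integrable fun z : ℂ => ‖f z‖ * Real.exp (-s * z.re) :=
    int_of_cc (by fun_prop) (hc.norm.mul_right)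
  have iw := int_weight h0 h1 0 hs
  have e3 : ∫ z in sector φ, Real.exp (-s * z.re) * ‖f z‖ ^ 2 ≤ ∫ z : ℂ, Real.exp (-s * z.re) * ‖f z‖ ^ 2 :=
    setIntegral_le_integral iF (Eventually.of_forall fun z => by positivity)
  have e2 : ∫ z in sector φ, ‖f z‖ * Real.exp (-s * z.re) ≤
      ∫ z in sector φ, (s ^ (N + 1) / 2 * (Real.exp (-s * z.re) * ‖f z‖ ^ 2) +
        1 / (2 * s ^ (N + 1)) * (‖z‖ ^ 0 * Real.exp (-s * z.re))) := by
    apply setIntegral_mono_on iA.integrableOn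
      (by exact (iF.integrableOn.const_mul _).add (iw.const_mul _)) (sector_meas φ)
    intro z hz
    have hl : 0 < s ^ (N + 1) := by positivity
    set l := s ^ (N + 1)
    have : ‖f z‖ ≤ l / 2 * ‖f z‖ ^ 2 + 1 / (2 * l) := by
      have e : l / 2 * ‖f z‖ ^ 2 + 1 / (2 * l) - ‖f z‖ = (l * ‖f z‖ - 1) ^ 2 / (2 * l) := by
        field_simp; ring
      have : 0 ≤ (l * ‖f z‖ - 1) ^ 2 / (2 * l) := by positivity
      linarith
    have := mul_le_mul_of_nonneg_left this (Real.exp_pos (-s * z.re)).le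
    nlinarith
  rw [integral_add (iF.integrableOn.const_mul _) (iw.const_mul _), integral_const_mul,
    integral_const_mul, weight_eq _ hs] at e2
  refine e2.trans ?_
  calc _ ≤ s ^ (N + 1) / 2 * (B / s ^ (2 * N + 4)) + 1 / (2 * s ^ (N + 1)) * (Jm φ 0 / s ^ (0 + 2)) := by
        gcongr; exact e3.trans h
    _ = _ := by
      rw [show 2 * N + 4 = (N + 1) + (N + 3) by ring, pow_add s (N + 1) (N + 3), show N + 3 = (N + 1) + 2 by ring,
        pow_add s (N + 1) 2, zero_add]
      have : s ^ (N + 1) ≠ 0 := by positivity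
      set l := s ^ (N + 1)
      field_simp

lemma main_gen {φ : ℝ} (h0 : 0 < φ) (h1 : φ < π / 2) {f : ℂ → ℂ} (hf : ContDiff ℝ 2 f)
    (hc : HasCompactSupport f) {R K : ℝ} (hR : 0 ≤ R) (hK : 0 ≤ K)
    (hsupp : ∀ z, f z ≠ 0 → |z.re| ≤ R) (N : ℕ) {P : ℂ → ℂ} {c0 : ℂ} {CP : ℝ}
    (hP : Continuous P) (hPs : ∀ (s : ℝ) z, P (s • z) = (s : ℂ) ^ N * P z)
    (hPb : ∀ z, ‖P z‖ ≤ CP * ‖z‖ ^ N)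
    (H0 : ∀ z, z ∉ sector φ → lapC f z = 0)
    (H1 : ∃ C, ∀ z ∈ sector φ, ‖lapC f z‖ ≤ K * ‖f z‖ + C * ‖z‖ ^ N)
    (H2 : ∀ ε > 0, ∃ C, ∀ z ∈ sector φ,
      ‖lapC f z - c0 * P z‖ ≤ K * ‖f z‖ + ε * ‖z‖ ^ N + C * ‖z‖ ^ (N + 1))
    {E : ℂ → ℂ} (hE : Continuous E) (hEn : ∀ z, ‖E z‖ = Real.exp (-z.re))
    (hEg : ∀ s : ℝ, ∫ z, lapC f z * E (s • z) = 0) :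
    c0 * ∫ z in sector φ, P z * E z = 0 := by
  obtain ⟨C, H1⟩ := H1
  obtain ⟨B, s0, hB, hs0, hL2⟩ := L2_bound h0 h1 hf hc hR hK hsupp N H0 H1
  have cf := C2.d hf |>.continuous
  have cl := C2.lapc hf
  set Q := c0 * ∫ z in sector φ, P z * E z with hQ
  have hEs : ∀ (s : ℝ) (z : ℂ), ‖E (s • z)‖ = Real.exp (-s * z.re) := by
    intro s z; rw [hEn]; simp
  have key : ∀ ε > 0, ∃ D, ∀ s, s0 ≤ s → ‖Q‖ ≤ ε * Jm φ N + D / s := by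
    intro ε hε
    obtain ⟨Ce, H2⟩ := H2 ε hε
    refine ⟨K * ((B + Jm φ 0) / 2) + Ce * Jm φ (N + 1), fun s hs => ?_⟩
    have hsp : 0 < s := lt_of_lt_of_le hs0 hs
    have iPE : IntegrableOn (fun z : ℂ => c0 * P z * E (s • z)) (sector φ) := by
      refine Integrable.mono' ((int_weight h0 h1 N hsp).const_mul (‖c0‖ * CP))
        (by apply Continuous.aestronglyMeasurable; fun_prop) (Eventually.of_forall fun z => ?_)
      rw [norm_mul, norm_mul, hEs]
      calc ‖c0‖ * ‖P z‖ * Real.exp (-s * z.re) ≤ ‖c0‖ * (CP * ‖z‖ ^ N) * Real.exp (-s * z.re) := by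
            gcongr; exact hPb z
        _ = _ := by ring
    have iLE : Integrable fun z : ℂ => lapC f z * E (s • z) :=
      int_of_cc (by fun_prop) (cs_lap hc).mul_right
    have e1 : ∫ z in sector φ, lapC f z * E (s • z) = 0 := by
      rw [setIntegral_eq_integral_of_forall_compl_eq_zero]
      · exact hEg s
      · intro z hz; simp [H0 z hz]
    have e2 : ∫ z in sector φ, c0 * P z * E (s • z) = Q / (s : ℂ) ^ (N + 2) := by
      have h := sector_scale (φ := φ) (fun z : ℂ => P z * E z) hsp
      simp only [hPs] at h
      have e : ∀ z : ℂ, c0 * P z * E (s • z) = (c0 / (s : ℂ) ^ N) * ((s : ℂ) ^ N * P z * E (s • z)) := by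
        intro z
        have : (s : ℂ) ≠ 0 := by exact_mod_cast hsp.ne'
        field_simp
      simp only [e]
      rw [integral_const_mul, h, hQ, pow_add, Complex.real_smul]
      push_cast
      have : (s : ℂ) ≠ 0 := by exact_mod_cast hsp.ne'
      field_simp
    have e3 : ‖Q‖ / s ^ (N + 2) ≤ ∫ z in sector φ, (K * (‖f z‖ * Real.exp (-s * z.re)) +
        ε * (‖z‖ ^ N * Real.exp (-s * z.re)) + Ce * (‖z‖ ^ (N + 1) * Real.exp (-s * z.re))) := by
      have : ‖Q‖ / s ^ (N + 2) = ‖∫ z in sector φ, (lapC f z * E (s • z) - c0 * P z * E (s • z))‖ := by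
        rw [integral_sub iLE.integrableOn iPE, e1, e2, zero_sub, norm_neg, norm_div, norm_pow, Complex.norm_real,
          Real.norm_of_nonneg hsp.le]
      rw [this]
      have iA : Integrable fun z : ℂ => ‖f z‖ * Real.exp (-s * z.re) :=
        int_of_cc (by fun_prop) (hc.norm.mul_right)
      apply norm_integral_le_of_norm_le
      · exact ((iA.integrableOn.const_mul _).add ((int_weight h0 h1 N hsp).const_mul _)).add
          ((int_weight h0 h1 (N + 1) hsp).const_mul _)
      · filter_upwards [ae_restrict_mem (sector_meas φ)] with z hz
        rw [← sub_mul, norm_mul, hEs]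
        calc _ ≤ (K * ‖f z‖ + ε * ‖z‖ ^ N + Ce * ‖z‖ ^ (N + 1)) * Real.exp (-s * z.re) := by
              gcongr; exact H2 z hz
          _ = _ := by ring
    have iA : Integrable fun z : ℂ => ‖f z‖ * Real.exp (-s * z.re) :=
        int_of_cc (by fun_prop) (hc.norm.mul_right)
    rw [integral_add (by exact (iA.integrableOn.const_mul _).add ((int_weight h0 h1 N hsp).const_mul _))
      ((int_weight h0 h1 (N + 1) hsp).const_mul _), integral_add (iA.integrableOn.const_mul _)
      ((int_weight h0 h1 N hsp).const_mul _), integral_const_mul, integral_const_mul, integral_const_mul,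
      weight_eq _ hsp, weight_eq _ hsp] at e3
    have hL1 := L1_bound h0 h1 cf hc N hsp (hL2 s hs)
    have e4 : ‖Q‖ / s ^ (N + 2) ≤ K * (((B + Jm φ 0) / 2) / s ^ (N + 3)) + ε * (Jm φ N / s ^ (N + 2))
        + Ce * (Jm φ (N + 1) / s ^ (N + 1 + 2)) := by
      refine e3.trans ?_
      gcongr
    have hl : 0 < s ^ (N + 2) := by positivity
    rw [div_le_iff₀ hl] at e4
    refine e4.trans (le_of_eq ?_)
    rw [show N + 1 + 2 = (N + 2) + 1 by ring, show N + 3 = (N + 2) + 1 by ring, pow_add s (N + 2) 1, pow_one]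
    set l := s ^ (N + 2)
    field_simp
    ring
  have key2 : ∀ ε > 0, ‖Q‖ ≤ ε * Jm φ N := by
    intro ε hε
    obtain ⟨D, hD⟩ := key ε hε
    have ht : Tendsto (fun s : ℝ => ε * Jm φ N + D / s) atTop (𝓝 (ε * Jm φ N + 0)) :=
      tendsto_const_nhds.add (tendsto_id.const_div_atTop D)
    rw [add_zero] at ht
    exact ge_of_tendsto ht ((eventually_ge_atTop s0).mono hD)
  have ht : Tendsto (fun ε : ℝ => ε * Jm φ N) (𝓝[>] 0) (𝓝 (0 * Jm φ N)) :=
    ((continuous_id.mul continuous_const).tendsto 0).mono_left nhdsWithin_le_nhds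
  rw [zero_mul] at ht
  have : ‖Q‖ ≤ 0 := ge_of_tendsto ht (by filter_upwards [self_mem_nhdsWithin] with ε hε using key2 ε hε)
  simpa using this

end CornerAux

namespace CornerAux
open Filter Topology
open scoped ComplexConjugate

lemma mem_polar {φ : ℝ} (h0 : 0 < φ) (h1 : φ < π / 2) {r θ : ℝ} (hr : 0 < r) (hθ : |θ| ≤ π) :
    (⟨r * Real.cos θ, r * Real.sin θ⟩ : ℂ) ∈ sector φ ↔ |θ| ≤ φ := by
  have hc : 0 < Real.cos φ := Real.cos_pos_of_mem_Ioo ⟨by linarith, h1⟩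
  have hs : |Real.sin θ| = Real.sin |θ| := by
    rcases le_total 0 θ with h | h
    · rw [abs_of_nonneg h] at hθ ⊢
      exact abs_of_nonneg (Real.sin_nonneg_of_nonneg_of_le_pi h hθ)
    · rw [abs_of_nonpos h] at hθ ⊢
      rw [Real.sin_neg, abs_of_nonpos]
      exact Real.sin_nonpos_of_nonpos_of_neg_pi_le h (by linarith)
  have e : (⟨r * Real.cos θ, r * Real.sin θ⟩ : ℂ) ∈ sector φ ↔ 0 ≤ Real.sin (φ - |θ|) := by
    change |r * Real.sin θ| ≤ Real.tan φ * (r * Real.cos θ) ↔ _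
    rw [abs_mul, abs_of_pos hr, hs, Real.sin_sub, Real.cos_abs, Real.tan_eq_sin_div_cos,
      div_mul_eq_mul_div, le_div_iff₀ hc]
    constructor
    · intro h
      have : r * (Real.sin |θ| * Real.cos φ) ≤ r * (Real.sin φ * Real.cos θ) := by linarith
      have := le_of_mul_le_mul_left this hr
      linarith
    · intro h
      nlinarith
  rw [e]
  constructor
  · intro h
    by_contra hlt
    push Not at hlt
    have := Real.sin_neg_of_neg_of_neg_pi_lt (x := φ - |θ|) (by linarith) (by linarith)
    linarith
  · intro h
    exact Real.sin_nonneg_of_nonneg_of_le_pi (by linarith) (by linarith [abs_nonneg θ])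

lemma polar_int {φ : ℝ} (h0 : 0 < φ) (h1 : φ < π / 2) {G : ℂ → ℂ} (hG : Continuous G) (N : ℕ)
    (hb : ∀ z, ‖G z‖ ≤ ‖z‖ ^ N * Real.exp (-z.re)) :
    ∫ z in sector φ, G z = ∫ θ in Icc (-φ) φ, ∫ r in Ioi (0:ℝ), (r : ℂ) * G (r * Complex.exp (θ * Complex.I)) := by
  have hc : 0 < Real.cos φ := Real.cos_pos_of_mem_Ioo ⟨by linarith, h1⟩
  have hsub : (Ioi (0:ℝ) ×ˢ Icc (-φ) φ) ⊆ polarCoord.target := by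
    rintro ⟨r, θ⟩ ⟨hr, hθ⟩
    simp only [polarCoord_target]
    exact ⟨hr, ⟨by linarith [hθ.1], by linarith [hθ.2]⟩⟩
  have hmeas : MeasurableSet (Ioi (0:ℝ) ×ˢ Icc (-φ) φ) := measurableSet_Ioi.prod measurableSet_Icc
  set g : ℝ × ℝ → ℂ := fun p => (p.1 : ℂ) * G (p.1 * Complex.exp (p.2 * Complex.I)) with hg
  have hgc : Continuous g := by simp only [hg]; fun_prop
  have e1 : ∫ z in sector φ, G z = ∫ p in Ioi (0:ℝ) ×ˢ Icc (-φ) φ, g p := by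
    rw [← integral_indicator (sector_meas φ), ← Complex.integral_comp_polarCoord_symm]
    rw [← inter_eq_self_of_subset_right hsub, ← setIntegral_indicator hmeas]
    refine setIntegral_congr_fun polarCoord.open_target.measurableSet ?_
    rintro ⟨r, θ⟩ hp
    simp only [polarCoord_target] at hp
    obtain ⟨hr, hθ⟩ := hp
    have hr' : 0 < r := hr
    have hθ' : |θ| ≤ π := abs_le.2 ⟨hθ.1.le, hθ.2.le⟩
    have ez : Complex.polarCoord.symm (r, θ) = (⟨r * Real.cos θ, r * Real.sin θ⟩ : ℂ) := by
      rw [Complex.polarCoord_symm_apply]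
      apply Complex.ext <;> simp [← Complex.ofReal_cos, ← Complex.ofReal_sin]
    have ez2 : (r : ℂ) * Complex.exp (θ * Complex.I) = (⟨r * Real.cos θ, r * Real.sin θ⟩ : ℂ) := by
      rw [Complex.exp_mul_I]
      apply Complex.ext <;> simp [← Complex.ofReal_cos, ← Complex.ofReal_sin]
    by_cases hm : |θ| ≤ φ
    · rw [indicator_of_mem (show (r, θ) ∈ Ioi (0:ℝ) ×ˢ Icc (-φ) φ from ⟨hr, abs_le.1 hm⟩)]
      simp only [ez]
      rw [indicator_of_mem ((mem_polar h0 h1 hr' hθ').2 hm)]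
      simp only [hg, ez2, Complex.real_smul]
    · rw [indicator_of_notMem (show (r, θ) ∉ Ioi (0:ℝ) ×ˢ Icc (-φ) φ from fun h => hm (abs_le.2 h.2))]
      simp only [ez]
      rw [indicator_of_notMem (fun h => hm ((mem_polar h0 h1 hr' hθ').1 h)), smul_zero]
  have hintg : IntegrableOn g (Ioi (0:ℝ) ×ˢ Icc (-φ) φ) := by
    have i1 : IntegrableOn (fun r : ℝ => r ^ (N + 1) * Real.exp (-Real.cos φ * r)) (Ioi 0) := by
      have h := integrableOn_rpow_mul_exp_neg_mul_rpow (s := N + 1) (p := 1) (b := Real.cos φ)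
        (by linarith [Nat.cast_nonneg (α := ℝ) N]) one_pos hc
      refine h.congr_fun (fun y hy => ?_) measurableSet_Ioi
      have : y ^ ((N:ℝ) + 1) = y ^ (N + 1) := by rw [← Real.rpow_natCast]; push_cast; rfl
      simp only [Real.rpow_one, this]
    have i2 : IntegrableOn (fun _ : ℝ => (1:ℝ)) (Icc (-φ) φ) := by
      exact continuous_const.integrableOn_Icc
    have i3 := Integrable.mul_prod i1 i2
    rw [Measure.prod_restrict] at i3
    refine Integrable.mono' i3 hgc.aestronglyMeasurable ?_
    change ∀ᵐ p ∂(volume.restrict (Ioi (0:ℝ) ×ˢ Icc (-φ) φ)), _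
    filter_upwards [ae_restrict_mem hmeas] with p hp
    obtain ⟨hr, hθ⟩ := hp
    have hr' : 0 < p.1 := hr
    simp only [hg, norm_mul, Complex.norm_real, mul_one, Real.norm_of_nonneg hr'.le]
    have hn : ‖(p.1 : ℂ) * Complex.exp (p.2 * Complex.I)‖ = p.1 := by
      rw [norm_mul, Complex.norm_exp_ofReal_mul_I, Complex.norm_real, Real.norm_of_nonneg hr'.le, mul_one]
    have hre : ((p.1 : ℂ) * Complex.exp (p.2 * Complex.I)).re = p.1 * Real.cos p.2 := by
      rw [Complex.exp_mul_I]; simp [← Complex.ofReal_cos, ← Complex.ofReal_sin]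
    have := hb ((p.1 : ℂ) * Complex.exp (p.2 * Complex.I))
    rw [hn, hre] at this
    have hcos : Real.cos φ ≤ Real.cos p.2 := by
      rw [← Real.cos_abs p.2]
      exact Real.cos_le_cos_of_nonneg_of_le_pi (abs_nonneg _) (by linarith) (abs_le.2 hθ)
    calc _ ≤ p.1 * (p.1 ^ N * Real.exp (-(p.1 * Real.cos p.2))) := by gcongr
      _ ≤ p.1 * (p.1 ^ N * Real.exp (-Real.cos φ * p.1)) := by
        apply mul_le_mul_of_nonneg_left _ hr'.le
        apply mul_le_mul_of_nonneg_left _ (by positivity)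
        apply Real.exp_le_exp.2
        nlinarith
      _ = _ := by ring
  rw [e1]
  rw [show (volume : Measure (ℝ × ℝ)) = (volume : Measure ℝ).prod volume from rfl] at hintg ⊢
  rw [IntegrableOn, ← Measure.prod_restrict] at hintg
  rw [← Measure.prod_restrict, integral_prod_symm _ hintg]

lemma pow_cexp_integrable (n : ℕ) {ω : ℂ} (hω : 0 < ω.re) :
    IntegrableOn (fun r : ℝ => (r : ℂ) ^ n * Complex.exp (-(ω * r))) (Ioi 0) := by
  have h := integrableOn_rpow_mul_exp_neg_mul_rpow (s := n) (p := 1) (b := ω.re)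
    (by linarith [Nat.cast_nonneg (α := ℝ) n]) one_pos hω
  refine Integrable.mono' h (Continuous.aestronglyMeasurable (by fun_prop)) ?_
  filter_upwards [ae_restrict_mem measurableSet_Ioi] with r hr
  have hr' : 0 < r := hr
  rw [norm_mul, norm_pow, Complex.norm_real, Real.norm_of_nonneg hr'.le, Complex.norm_exp, Real.rpow_natCast,
    Real.rpow_one]
  simp

lemma pow_cexp_tendsto (n : ℕ) {ω : ℂ} (hω : 0 < ω.re) :
    Tendsto (fun r : ℝ => (r : ℂ) ^ n * Complex.exp (-(ω * r))) atTop (𝓝 0) := by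
  rw [tendsto_zero_iff_norm_tendsto_zero]
  refine (tendsto_rpow_mul_exp_neg_mul_atTop_nhds_zero (n : ℝ) ω.re hω).congr' ?_
  filter_upwards [eventually_gt_atTop 0] with r hr
  rw [norm_mul, norm_pow, Complex.norm_real, Real.norm_of_nonneg hr.le, Complex.norm_exp, Real.rpow_natCast]
  simp

lemma hasDerivAt_cexp_ray (ω : ℂ) (r : ℝ) : HasDerivAt (fun r : ℝ => Complex.exp (-(ω * r)))
    (-ω * Complex.exp (-(ω * r))) r := by
  have h := (((hasDerivAt_id r).ofReal_comp.const_mul ω).fun_neg).cexp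
  refine h.congr_deriv ?_
  simp; ring

lemma gamma_int0 (n : ℕ) {ω : ℂ} (hω : 0 < ω.re) :
    ∫ r in Ioi (0:ℝ), (r : ℂ) ^ n * Complex.exp (-(ω * r)) = n.factorial / ω ^ (n + 1) := by
  have hne : ω ≠ 0 := by rintro rfl; simp at hω
  induction n with
  | zero =>
    have h := integral_Ioi_of_hasDerivAt_of_tendsto' (a := 0) (fun r _ => hasDerivAt_cexp_ray ω r)
      (by simpa [IntegrableOn] using (pow_cexp_integrable 0 hω).const_mul (-ω)) (by simpa using pow_cexp_tendsto 0 hω)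
    rw [integral_const_mul] at h
    simp only [pow_zero, one_mul]
    simp at h ⊢
    field_simp
    linear_combination h
  | succ n ih =>
    have hd : ∀ r : ℝ, HasDerivAt (fun r : ℝ => (r : ℂ) ^ (n + 1) * Complex.exp (-(ω * r)))
        ((n + 1 : ℂ) * ((r : ℂ) ^ n * Complex.exp (-(ω * r))) - ω * ((r : ℂ) ^ (n + 1) * Complex.exp (-(ω * r)))) r := by
      intro r
      have h := ((hasDerivAt_id r).ofReal_comp.pow (n + 1)).mul (hasDerivAt_cexp_ray ω r)
      refine h.congr_deriv ?_
      simp; ring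
    have h := integral_Ioi_of_hasDerivAt_of_tendsto' (a := 0) (fun r _ => hd r)
      (by exact ((pow_cexp_integrable n hω).const_mul _).sub ((pow_cexp_integrable (n+1) hω).const_mul _)) (pow_cexp_tendsto (n + 1) hω)
    rw [integral_sub ((pow_cexp_integrable n hω).const_mul _) ((pow_cexp_integrable (n+1) hω).const_mul _),
      integral_const_mul, integral_const_mul, ih] at h
    simp at h
    rw [Nat.factorial_succ]
    push_cast
    rw [eq_div_iff (pow_ne_zero _ hne), pow_succ]
    field_simp at h
    linear_combination -h

lemma gamma_int (N : ℕ) (ω : ℂ) (hω : 0 < ω.re) :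
    ∫ r in Ioi (0:ℝ), (r : ℂ) ^ (N + 1) * Complex.exp (-(ω * r)) = (N + 1).factorial / ω ^ (N + 2) :=
  gamma_int0 (N + 1) hω

lemma angle_int {φ : ℝ} (h0 : 0 < φ) (m : ℕ) (hm : 0 < m) :
    ∫ θ in Icc (-φ) φ, (Complex.exp (θ * Complex.I) ^ m)⁻¹ = ((2 * Real.sin (m * φ) / m : ℝ) : ℂ) := by
  have hm' : (m : ℂ) ≠ 0 := by exact_mod_cast hm.ne'
  rw [integral_Icc_eq_integral_Ioc, ← intervalIntegral.integral_of_le (by linarith)]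
  have e : ∀ θ : ℝ, (Complex.exp (θ * Complex.I) ^ m)⁻¹ = Complex.exp ((-(m * Complex.I)) * θ) := by
    intro θ
    rw [← Complex.exp_nat_mul, ← Complex.exp_neg]; congr 1; ring
  simp only [e]
  rw [integral_exp_mul_complex (by simp [hm'])]
  push_cast
  rw [Complex.sin]
  have e1 : -((m:ℂ) * Complex.I) * φ = -(m * φ) * Complex.I := by ring
  have e2 : -((m:ℂ) * Complex.I) * -φ = (m * φ) * Complex.I := by ring
  rw [e1, e2]
  field_simp
  linear_combination (-Complex.exp (-(m * φ * Complex.I)) + Complex.exp (m * φ * Complex.I)) * Complex.I_mul_I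

noncomputable def S1 (φ : ℝ) (N : ℕ) : ℝ := (N + 1).factorial * Real.sin (2 * φ)
noncomputable def S2 (φ : ℝ) (N : ℕ) : ℝ := (N + 1).factorial * (Real.sin ((2 * N + 2) * φ) / (N + 1))

lemma int_S1 {φ : ℝ} (h0 : 0 < φ) (h1 : φ < π / 2) (N : ℕ) :
    ∫ z in sector φ, z ^ N * Complex.exp (-z) = (S1 φ N : ℂ) := by
  rw [polar_int h0 h1 (by fun_prop) N (by intro z; simp [Complex.norm_exp])]
  have : ∀ θ ∈ Icc (-φ) φ, (∫ r in Ioi (0:ℝ), (r : ℂ) * (((r : ℂ) * Complex.exp (θ * Complex.I)) ^ N *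
      Complex.exp (-((r : ℂ) * Complex.exp (θ * Complex.I))))) = (N + 1).factorial * (Complex.exp (θ * Complex.I) ^ 2)⁻¹ := by
    intro θ hθ
    have hω : 0 < (Complex.exp (θ * Complex.I)).re := by
      rw [Complex.exp_ofReal_mul_I_re]
      exact Real.cos_pos_of_mem_Ioo ⟨by linarith [hθ.1], by linarith [hθ.2]⟩
    have hne := Complex.exp_ne_zero (θ * Complex.I)
    set ω := Complex.exp (θ * Complex.I)
    have e : ∀ r : ℝ, (r : ℂ) * (((r : ℂ) * ω) ^ N * Complex.exp (-((r : ℂ) * ω))) =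
        ω ^ N * ((r : ℂ) ^ (N + 1) * Complex.exp (-(ω * r))) := by
      intro r; rw [mul_comm ω r]; ring
    simp only [e]
    rw [integral_const_mul, gamma_int N ω hω, pow_add]
    field_simp
  rw [setIntegral_congr_fun measurableSet_Icc this, integral_const_mul, angle_int h0 2 (by norm_num), S1]
  push_cast; ring

lemma int_S2 {φ : ℝ} (h0 : 0 < φ) (h1 : φ < π / 2) (N : ℕ) :
    ∫ z in sector φ, conj z ^ N * Complex.exp (-z) = (S2 φ N : ℂ) := by
  rw [polar_int h0 h1 (by fun_prop) N (by intro z; simp [Complex.norm_exp])]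
  have : ∀ θ ∈ Icc (-φ) φ, (∫ r in Ioi (0:ℝ), (r : ℂ) * ((conj ((r : ℂ) * Complex.exp (θ * Complex.I))) ^ N *
      Complex.exp (-((r : ℂ) * Complex.exp (θ * Complex.I))))) =
        (N + 1).factorial * (Complex.exp (θ * Complex.I) ^ (2 * N + 2))⁻¹ := by
    intro θ hθ
    have hω : 0 < (Complex.exp (θ * Complex.I)).re := by
      rw [Complex.exp_ofReal_mul_I_re]
      exact Real.cos_pos_of_mem_Ioo ⟨by linarith [hθ.1], by linarith [hθ.2]⟩
    have hne := Complex.exp_ne_zero (θ * Complex.I)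
    have hcj : conj (Complex.exp (θ * Complex.I)) = (Complex.exp (θ * Complex.I))⁻¹ := by
      rw [← Complex.exp_conj, ← Complex.exp_neg]; simp
    set ω := Complex.exp (θ * Complex.I)
    have e : ∀ r : ℝ, (r : ℂ) * ((conj ((r : ℂ) * ω)) ^ N * Complex.exp (-((r : ℂ) * ω))) =
        (ω ^ N)⁻¹ * ((r : ℂ) ^ (N + 1) * Complex.exp (-(ω * r))) := by
      intro r; rw [map_mul, hcj, Complex.conj_ofReal, mul_comm ω r, mul_pow, inv_pow]; ring
    simp only [e]
    rw [integral_const_mul, gamma_int N ω hω, show 2 * N + 2 = N + (N + 2) by ring, pow_add ω N (N + 2)]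
    field_simp
  rw [setIntegral_congr_fun measurableSet_Icc this, integral_const_mul, angle_int h0 _ (by positivity), S2]
  push_cast
  have : (N : ℂ) + 1 ≠ 0 := by exact_mod_cast Nat.succ_ne_zero N
  have h2 : (2 * N : ℂ) + 2 ≠ 0 := by
    rw [show (2 * N : ℂ) + 2 = 2 * (N + 1) by ring]; exact mul_ne_zero two_ne_zero this
  field_simp

lemma int_S1' {φ : ℝ} (h0 : 0 < φ) (h1 : φ < π / 2) (N : ℕ) :
    ∫ z in sector φ, conj z ^ N * Complex.exp (-conj z) = (S1 φ N : ℂ) := by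
  rw [← Complex.conj_ofReal, ← int_S1 h0 h1 N, ← integral_conj]
  simp [← Complex.exp_conj]

lemma int_S2' {φ : ℝ} (h0 : 0 < φ) (h1 : φ < π / 2) (N : ℕ) :
    ∫ z in sector φ, z ^ N * Complex.exp (-conj z) = (S2 φ N : ℂ) := by
  rw [← Complex.conj_ofReal, ← int_S2 h0 h1 N, ← integral_conj]
  simp [← Complex.exp_conj]

lemma sin_nat_le {x : ℝ} (hx : 0 < x) (hx' : x < π) (n : ℕ) : |Real.sin ((n + 1 : ℝ) * x)| ≤ (n + 1) * Real.sin x ∧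
    (1 ≤ n → |Real.sin ((n + 1 : ℝ) * x)| < (n + 1) * Real.sin x) := by
  have hs : 0 < Real.sin x := Real.sin_pos_of_pos_of_lt_pi hx hx'
  have hcos : |Real.cos x| < 1 := by
    rw [← sq_lt_one_iff_abs_lt_one]
    nlinarith [Real.sin_sq_add_cos_sq x]
  induction n with
  | zero => simp [abs_of_pos hs]
  | succ n ih =>
    have h : |Real.sin (((n + 1 : ℕ) + 1 : ℝ) * x)| < ((n + 1 : ℕ) + 1) * Real.sin x := by
      push_cast
      rw [show ((n : ℝ) + 1 + 1) * x = (n + 1) * x + x by ring, Real.sin_add]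
      calc _ ≤ |Real.sin ((n + 1) * x) * Real.cos x| + |Real.cos ((n + 1) * x) * Real.sin x| := abs_add_le _ _
        _ = |Real.sin ((n + 1) * x)| * |Real.cos x| + |Real.cos ((n + 1) * x)| * Real.sin x := by
          rw [abs_mul, abs_mul, abs_of_pos hs]
        _ ≤ ((n + 1) * Real.sin x) * |Real.cos x| + 1 * Real.sin x := by
          gcongr
          · exact ih.1
          · exact Real.abs_cos_le_one _
        _ < ((n + 1) * Real.sin x) * 1 + 1 * Real.sin x := by gcongr
        _ = _ := by ring
    exact ⟨h.le, fun _ => h⟩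

lemma pow_exp_int {φ : ℝ} (h0 : 0 < φ) (h1 : φ < π / 2) {G : ℂ → ℂ} (hG : Continuous G) (N : ℕ)
    (hb : ∀ z, ‖G z‖ ≤ ‖z‖ ^ N * Real.exp (-z.re)) : IntegrableOn G (sector φ) := by
  have := int_weight h0 h1 N one_pos
  refine Integrable.mono' this hG.aestronglyMeasurable (Eventually.of_forall fun z => ?_)
  simpa using hb z

lemma no_annihilate {φ : ℝ} (h0 : 0 < φ) (h1 : φ < π / 2) (N : ℕ) (a b : ℂ) (hN : N = 0 → b = 0)
    (e1 : ∫ z in sector φ, (a * z ^ N + b * conj z ^ N) * Complex.exp (-z) = 0)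
    (e2 : ∫ z in sector φ, (a * z ^ N + b * conj z ^ N) * Complex.exp (-conj z) = 0) : a = 0 ∧ b = 0 := by
  have hs : 0 < Real.sin (2 * φ) := Real.sin_pos_of_pos_of_lt_pi (by linarith) (by linarith)
  have i1 : IntegrableOn (fun z : ℂ => z ^ N * Complex.exp (-z)) (sector φ) :=
    pow_exp_int h0 h1 (by fun_prop) N (by intro z; simp [Complex.norm_exp])
  have i2 : IntegrableOn (fun z : ℂ => conj z ^ N * Complex.exp (-z)) (sector φ) :=
    pow_exp_int h0 h1 (by fun_prop) N (by intro z; simp [Complex.norm_exp])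
  have i3 : IntegrableOn (fun z : ℂ => z ^ N * Complex.exp (-conj z)) (sector φ) :=
    pow_exp_int h0 h1 (by fun_prop) N (by intro z; simp [Complex.norm_exp])
  have i4 : IntegrableOn (fun z : ℂ => conj z ^ N * Complex.exp (-conj z)) (sector φ) :=
    pow_exp_int h0 h1 (by fun_prop) N (by intro z; simp [Complex.norm_exp])
  simp only [add_mul, mul_assoc] at e1 e2
  rw [integral_add (i1.const_mul a) (i2.const_mul b), integral_const_mul, integral_const_mul,
    int_S1 h0 h1, int_S2 h0 h1] at e1
  rw [integral_add (i3.const_mul a) (i4.const_mul b), integral_const_mul, integral_const_mul,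
    int_S1' h0 h1, int_S2' h0 h1] at e2
  have hS1 : 0 < S1 φ N := by unfold S1; positivity
  have hS1c : (S1 φ N : ℂ) ≠ 0 := by exact_mod_cast hS1.ne'
  rcases Nat.eq_zero_or_pos N with h | h
  · have hb := hN h
    refine ⟨?_, hb⟩
    rw [hb, zero_mul, add_zero] at e1
    exact (mul_eq_zero.1 e1).resolve_right hS1c
  · have hlt : |S2 φ N| < S1 φ N := by
      unfold S1 S2
      rw [abs_mul, abs_of_pos (by positivity : (0:ℝ) < (N + 1).factorial), abs_div, abs_of_pos (by positivity : (0:ℝ) < N + 1)]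
      apply mul_lt_mul_of_pos_left _ (by positivity)
      rw [div_lt_iff₀ (by positivity)]
      have := (sin_nat_le (x := 2 * φ) (by linarith) (by linarith) N).2 h
      rw [show (2 * N + 2 : ℝ) * φ = (N + 1) * (2 * φ) by ring]
      linarith
    have hd : S1 φ N ^ 2 - S2 φ N ^ 2 ≠ 0 := by
      have := sq_lt_sq' (neg_lt_of_abs_lt hlt) (lt_of_abs_lt hlt)
      linarith
    have hdc : (S1 φ N : ℂ) ^ 2 - (S2 φ N : ℂ) ^ 2 ≠ 0 := by exact_mod_cast hd
    constructor
    · apply (mul_eq_zero.1 (_ : a * ((S1 φ N : ℂ) ^ 2 - (S2 φ N : ℂ) ^ 2) = 0)).resolve_right hdc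
      linear_combination (S1 φ N : ℂ) * e1 - (S2 φ N : ℂ) * e2
    · apply (mul_eq_zero.1 (_ : b * ((S1 φ N : ℂ) ^ 2 - (S2 φ N : ℂ) ^ 2) = 0)).resolve_right hdc
      linear_combination (S1 φ N : ℂ) * e2 - (S2 φ N : ℂ) * e1

end CornerAux

namespace CornerAux
open Filter Topology
open scoped ComplexConjugate

section ev
variable {E : Type*} [NormedAddCommGroup E] [NormedSpace ℝ E]

lemma dX_ev {f g : ℂ → E} {z : ℂ} (h : f =ᶠ[𝓝 z] g) : dX f =ᶠ[𝓝 z] dX g := by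
  filter_upwards [h.fderiv (𝕜 := ℝ)] with y hy
  unfold dX; rw [hy]
lemma dY_ev {f g : ℂ → E} {z : ℂ} (h : f =ᶠ[𝓝 z] g) : dY f =ᶠ[𝓝 z] dY g := by
  filter_upwards [h.fderiv (𝕜 := ℝ)] with y hy
  unfold dY; rw [hy]
lemma lapC_ev {f g : ℂ → E} {z : ℂ} (h : f =ᶠ[𝓝 z] g) : lapC f z = lapC g z := by
  unfold lapC
  rw [(dX_ev (dX_ev h)).eq_of_nhds, (dY_ev (dY_ev h)).eq_of_nhds]
lemma dX_c (c : E) (z : ℂ) : dX (fun _ : ℂ => c) z = 0 := by unfold dX; simp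
lemma dY_c (c : E) (z : ℂ) : dY (fun _ : ℂ => c) z = 0 := by unfold dY; simp
lemma lapC_c (c : E) (z : ℂ) : lapC (fun _ : ℂ => c) z = 0 := by
  have e1 : dX (fun _ : ℂ => c) = fun _ => 0 := by ext z; exact dX_c c z
  have e2 : dY (fun _ : ℂ => c) = fun _ => 0 := by ext z; exact dY_c c z
  unfold lapC; rw [e1, e2, dX_c, dY_c, add_zero]
end ev

lemma core (k : ℝ) (hk : 0 < k) {φ : ℝ} (h0 : 0 < φ) (h1 : φ < π / 2) {u v q : ℂ → ℂ}
    (hu : ContDiff ℝ 2 u) (hv : ContDiff ℝ 2 v)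
    (hpv : ∀ z, lapC v z = -(k : ℂ) ^ 2 * v z)
    (hpu : ∀ z, lapC u z = -(k : ℂ) ^ 2 * q z * u z)
    (heq : ∀ z, z ∉ sector φ → u z = v z) {M : ℝ} (hM : ∀ z, ‖q z‖ ≤ M)
    (hq : ∀ ε > 0, ∃ δ > 0, ∀ z ∈ sector φ, ‖z‖ < δ → ‖q z - q 0‖ ≤ ε) (hq0 : q 0 ≠ 1) :
    ∀ z, v z = 0 := by
  rcases helm_asymp k hv hpv with h | ⟨N, a, b, δ, C, hab, hN, hδ, hC, has⟩
  · exact h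
  exfalso
  have hcos : 0 < Real.cos φ := Real.cos_pos_of_mem_Ioo ⟨by linarith, h1⟩
  have hM0 : 0 ≤ M := (norm_nonneg _).trans (hM 0)
  set R := δ * Real.cos φ with hR
  have hRp : 0 < R := by positivity
  have hRδ : R ≤ δ := by
    have := Real.cos_le_one φ
    nlinarith
  -- cutoff
  set ψ : ℂ → ℂ := fun z => ((Real.smoothTransition (2 - 2 * z.re / R) : ℝ) : ℂ) with hψ
  have hψc : ContDiff ℝ 2 ψ := by
    have e1 : ContDiff ℝ 2 (fun z : ℂ => 2 - 2 * z.re / R) := by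
      have : ContDiff ℝ 2 (fun z : ℂ => z.re) := Complex.reCLM.contDiff
      fun_prop
    have e2 : ContDiff ℝ 2 Real.smoothTransition := Real.smoothTransition.contDiff
    exact Complex.ofRealCLM.contDiff.comp (e2.comp e1)
  have hψ1 : ∀ z : ℂ, z.re ≤ R / 2 → ψ z = 1 := by
    intro z hz
    simp only [hψ]
    rw [Real.smoothTransition.one_of_one_le]
    · simp
    · have : 2 * z.re / R ≤ 1 := by rw [div_le_one hRp]; linarith
      linarith
  have hψ0 : ∀ z : ℂ, R ≤ z.re → ψ z = 0 := by
    intro z hz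
    simp only [hψ]
    rw [Real.smoothTransition.zero_of_nonpos]
    · simp
    · have : 2 ≤ 2 * z.re / R := by rw [le_div_iff₀ hRp]; linarith
      linarith
  have hψn : ∀ z, ‖ψ z‖ ≤ 1 := by
    intro z
    simp only [hψ, Complex.norm_real]
    rw [Real.norm_of_nonneg (Real.smoothTransition.nonneg _)]
    exact Real.smoothTransition.le_one _
  set w : ℂ → ℂ := fun z => u z - v z with hw
  have hwc : ContDiff ℝ 2 w := hu.sub hv
  have hw0 : ∀ z, z ∉ sector φ → w =ᶠ[𝓝 z] fun _ => 0 := by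
    intro z hz
    filter_upwards [(sector_closed φ).isOpen_compl.mem_nhds hz] with y hy
    simp only [hw, heq y hy, sub_self]
  set f : ℂ → ℂ := fun z => ψ z * w z with hf
  have hfc : ContDiff ℝ 2 f := hψc.mul hwc
  set E : ℂ → ℂ := fun z => lapC ψ z * w z + 2 * (dX ψ z * dX w z + dY ψ z * dY w z) with hE
  have hEc : Continuous E := by
    have c1 := C2.lapc hψc
    have c2 := hwc.continuous
    have c3 := (C2.dX1 hψc).continuous
    have c4 := (C2.dY1 hψc).continuous
    have c5 := (C2.dX1 hwc).continuous
    have c6 := (C2.dY1 hwc).continuous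
    simp only [hE]; fun_prop
  have hlw : ∀ z, lapC w z = -(k : ℂ) ^ 2 * q z * w z + (k : ℂ) ^ 2 * (1 - q z) * v z := by
    intro z
    simp only [hw]
    rw [lapC_sub hu hv, hpu, hpv]; ring
  have hlf : ∀ z, lapC f z = -(k : ℂ) ^ 2 * q z * f z + (k : ℂ) ^ 2 * ((1 - q z) * (ψ z * v z)) + E z := by
    intro z
    simp only [hf, hE]
    rw [lapC_mul hψc hwc, hlw]; ring
  have hEψ : ∀ z c, ψ =ᶠ[𝓝 z] (fun _ => c) → E z = 0 := by
    intro z c h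
    simp only [hE]
    rw [lapC_ev h, (dX_ev h).eq_of_nhds, (dY_ev h).eq_of_nhds, lapC_c, dX_c, dY_c]; simp
  have hElow : ∀ z : ℂ, z.re < R / 2 → E z = 0 := by
    intro z hz
    apply hEψ z 1
    filter_upwards [(isOpen_lt Complex.continuous_re continuous_const).mem_nhds hz] with y hy
    exact hψ1 y (le_of_lt hy)
  have hEhigh : ∀ z : ℂ, R < z.re → E z = 0 := by
    intro z hz
    apply hEψ z 0
    filter_upwards [(isOpen_lt continuous_const Complex.continuous_re).mem_nhds hz] with y hy
    exact hψ0 y (le_of_lt hy)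
  have hsecδ : ∀ z ∈ sector φ, z.re ≤ R → ‖z‖ ≤ δ := by
    intro z hz hr
    have := (sector_norm h0 h1 hz).trans hr
    rw [hR, mul_comm δ] at this
    exact le_of_mul_le_mul_left this hcos
  have hfsupp : ∀ z, f z ≠ 0 → z ∈ sector φ ∧ z.re ≤ R := by
    intro z hz
    constructor
    · by_contra hn
      exact hz (by simp only [hf]; rw [(hw0 z hn).eq_of_nhds, mul_zero])
    · by_contra hn
      push Not at hn
      exact hz (by simp only [hf]; rw [hψ0 z hn.le, zero_mul])
  have hcs : HasCompactSupport f := by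
    apply HasCompactSupport.intro (isCompact_closedBall (0:ℂ) δ)
    intro z hz
    by_contra hn
    obtain ⟨h2, h3⟩ := hfsupp z hn
    exact hz (by simpa using hsecδ z h2 h3)
  obtain ⟨CE, hCE⟩ := (isCompact_closedBall (0:ℂ) δ).exists_bound_of_continuousOn hEc.continuousOn
  have hCE0 : 0 ≤ CE := (norm_nonneg _).trans (hCE 0 (by simp [hδ.le]))
  have hEb : ∀ m : ℕ, ∀ z ∈ sector φ, ‖E z‖ ≤ CE * (2 / R) ^ m * ‖z‖ ^ m := by
    intro m z hz
    by_cases hlo : z.re < R / 2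
    · rw [hElow z hlo]; simp; positivity
    by_cases hhi : R < z.re
    · rw [hEhigh z hhi]; simp; positivity
    push Not at hlo hhi
    have hz1 : ‖E z‖ ≤ CE := hCE z (by simpa using hsecδ z hz hhi)
    have hz2 : 1 ≤ (2 / R * ‖z‖) ^ m := by
      apply one_le_pow₀
      have := hlo.trans (Complex.re_le_norm z)
      rw [div_mul_eq_mul_div, le_div_iff₀ hRp]; linarith
    rw [mul_assoc, ← mul_pow]
    exact hz1.trans (le_mul_of_one_le_right hCE0 hz2)
  set P : ℂ → ℂ := fun z => a * z ^ N + b * conj z ^ N with hP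
  set CP := ‖a‖ + ‖b‖ with hCP
  have hCP0 : 0 ≤ CP := by positivity
  have hPb : ∀ z, ‖P z‖ ≤ CP * ‖z‖ ^ N := by
    intro z
    simp only [hP]
    refine (norm_add_le _ _).trans (le_of_eq ?_)
    simp only [norm_mul, norm_pow, RCLike.norm_conj, hCP]; ring
  have hψv : ∀ z ∈ sector φ, ‖ψ z * v z‖ ≤ (CP + C * δ) * ‖z‖ ^ N := by
    intro z hz
    by_cases hhi : R ≤ z.re
    · rw [hψ0 z hhi, zero_mul, norm_zero]; positivity
    push Not at hhi
    have hzδ := hsecδ z hz hhi.le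
    have hvb : ‖v z‖ ≤ (CP + C * δ) * ‖z‖ ^ N := by
      calc ‖v z‖ = ‖P z + (v z - P z)‖ := by congr 1; ring
        _ ≤ ‖P z‖ + ‖v z - P z‖ := norm_add_le _ _
        _ ≤ CP * ‖z‖ ^ N + C * ‖z‖ ^ (N + 1) := add_le_add (hPb z) (has z hzδ)
        _ = CP * ‖z‖ ^ N + C * ‖z‖ * ‖z‖ ^ N := by ring
        _ ≤ CP * ‖z‖ ^ N + C * δ * ‖z‖ ^ N := by gcongr
        _ = _ := by ring
    rw [norm_mul]
    calc _ ≤ 1 * ‖v z‖ := by gcongr; exact hψn z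
      _ ≤ _ := by rw [one_mul]; exact hvb
  have h1q : ∀ z, ‖1 - q z‖ ≤ 1 + M := by
    intro z
    refine (norm_sub_le _ _).trans ?_
    simpa using hM z
  have hk2 : ‖(k : ℂ) ^ 2‖ = k ^ 2 := by
    rw [norm_pow, Complex.norm_real, Real.norm_of_nonneg hk.le]
  have hqf : ∀ z, ‖-(k : ℂ) ^ 2 * q z * f z‖ ≤ (k ^ 2 * M) * ‖f z‖ := by
    intro z
    rw [norm_mul, norm_mul, norm_neg, hk2]
    gcongr
    exact hM z
  have H0 : ∀ z, z ∉ sector φ → lapC f z = 0 := by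
    intro z hz
    have : f =ᶠ[𝓝 z] fun _ => 0 := by
      filter_upwards [hw0 z hz] with y hy
      simp only [hf, hy, mul_zero]
    rw [lapC_ev this, lapC_c]
  have H1 : ∃ C', ∀ z ∈ sector φ, ‖lapC f z‖ ≤ (k ^ 2 * M) * ‖f z‖ + C' * ‖z‖ ^ N := by
    refine ⟨k ^ 2 * ((1 + M) * (CP + C * δ)) + CE * (2 / R) ^ N, fun z hz => ?_⟩
    rw [hlf]
    calc _ ≤ ‖-(k : ℂ) ^ 2 * q z * f z‖ + ‖(k : ℂ) ^ 2 * ((1 - q z) * (ψ z * v z))‖ + ‖E z‖ := norm_add₃_le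
      _ ≤ (k ^ 2 * M) * ‖f z‖ + k ^ 2 * ((1 + M) * ((CP + C * δ) * ‖z‖ ^ N)) + CE * (2 / R) ^ N * ‖z‖ ^ N := by
        apply add_le_add (add_le_add (hqf z) _) (hEb N z hz)
        rw [norm_mul, norm_mul, hk2]
        gcongr
        · exact h1q z
        · exact hψv z hz
      _ = _ := by ring
  have H2 : ∀ ε > 0, ∃ C', ∀ z ∈ sector φ, ‖lapC f z - ((k : ℂ) ^ 2 * (1 - q 0)) * P z‖ ≤
      (k ^ 2 * M) * ‖f z‖ + ε * ‖z‖ ^ N + C' * ‖z‖ ^ (N + 1) := by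
    intro ε hε
    obtain ⟨δ', hδ', hqδ⟩ := hq (ε / (k ^ 2 * (CP + 1))) (by positivity)
    set ρ := min δ' (R / 2) with hρ
    have hρp : 0 < ρ := lt_min hδ' (by positivity)
    set C1 := (1 + M) * C with hC1
    set C2' := ((1 + M) * (CP + C * δ) + (1 + M) * CP) / ρ with hC2
    have hC10 : 0 ≤ C1 := by positivity
    have hC20 : 0 ≤ C2' := by positivity
    refine ⟨k ^ 2 * (C1 + C2') + CE * (2 / R) ^ (N + 1), fun z hz => ?_⟩
    have hD : k ^ 2 * ‖(1 - q z) * (ψ z * v z) - (1 - q 0) * P z‖ ≤ ε * ‖z‖ ^ N + k ^ 2 * (C1 + C2') * ‖z‖ ^ (N + 1) := by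
      by_cases hzρ : ‖z‖ < ρ
      · have hz1 : ‖z‖ < δ' := hzρ.trans_le (min_le_left _ _)
        have hz2 : ‖z‖ < R / 2 := hzρ.trans_le (min_le_right _ _)
        rw [hψ1 z ((Complex.re_le_norm z).trans hz2.le)]
        have e : (1 - q z) * (1 * v z) - (1 - q 0) * P z = (1 - q z) * (v z - P z) - (q z - q 0) * P z := by ring
        rw [e]
        have hb1 : ‖(1 - q z) * (v z - P z) - (q z - q 0) * P z‖ ≤
            (1 + M) * (C * ‖z‖ ^ (N + 1)) + ε / (k ^ 2 * (CP + 1)) * (CP * ‖z‖ ^ N) := by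
          refine (norm_sub_le _ _).trans ?_
          rw [norm_mul, norm_mul]
          gcongr
          · exact h1q z
          · exact has z (by linarith)
          · exact hqδ z hz hz1
          · exact hPb z
        have hb2 : k ^ 2 * (ε / (k ^ 2 * (CP + 1)) * (CP * ‖z‖ ^ N)) ≤ ε * ‖z‖ ^ N := by
          have : k ^ 2 * (ε / (k ^ 2 * (CP + 1)) * (CP * ‖z‖ ^ N)) = (CP / (CP + 1)) * (ε * ‖z‖ ^ N) := by
            field_simp
          rw [this]
          apply mul_le_of_le_one_left (by positivity)
          rw [div_le_one (by positivity)]; linarith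
        calc _ ≤ k ^ 2 * ((1 + M) * (C * ‖z‖ ^ (N + 1)) + ε / (k ^ 2 * (CP + 1)) * (CP * ‖z‖ ^ N)) := by gcongr
          _ = k ^ 2 * (ε / (k ^ 2 * (CP + 1)) * (CP * ‖z‖ ^ N)) + k ^ 2 * (C1 + 0) * ‖z‖ ^ (N + 1) := by
            rw [hC1]; ring
          _ ≤ _ := by gcongr
      · push Not at hzρ
        have hb1 : ‖(1 - q z) * (ψ z * v z) - (1 - q 0) * P z‖ ≤
            (1 + M) * ((CP + C * δ) * ‖z‖ ^ N) + (1 + M) * (CP * ‖z‖ ^ N) := by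
          refine (norm_sub_le _ _).trans ?_
          rw [norm_mul, norm_mul (1 - q 0)]
          gcongr
          · exact h1q z
          · exact hψv z hz
          · exact h1q 0
          · exact hPb z
        have hb2 : (1 + M) * ((CP + C * δ) * ‖z‖ ^ N) + (1 + M) * (CP * ‖z‖ ^ N) ≤ C2' * ‖z‖ ^ (N + 1) := by
          have : (1 + M) * ((CP + C * δ) * ‖z‖ ^ N) + (1 + M) * (CP * ‖z‖ ^ N) = C2' * (ρ * ‖z‖ ^ N) := by
            rw [hC2]; field_simp
          rw [this, pow_succ, mul_comm (‖z‖ ^ N)]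
          gcongr
        calc _ ≤ k ^ 2 * (C2' * ‖z‖ ^ (N + 1)) := by gcongr; exact hb1.trans hb2
          _ = 0 + k ^ 2 * (0 + C2') * ‖z‖ ^ (N + 1) := by ring
          _ ≤ _ := by gcongr; positivity
    rw [hlf]
    have e : -(k : ℂ) ^ 2 * q z * f z + (k : ℂ) ^ 2 * ((1 - q z) * (ψ z * v z)) + E z - (k : ℂ) ^ 2 * (1 - q 0) * P z
      = -(k : ℂ) ^ 2 * q z * f z + (k : ℂ) ^ 2 * ((1 - q z) * (ψ z * v z) - (1 - q 0) * P z) + E z := by ring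
    rw [e]
    calc _ ≤ ‖-(k : ℂ) ^ 2 * q z * f z‖ + ‖(k : ℂ) ^ 2 * ((1 - q z) * (ψ z * v z) - (1 - q 0) * P z)‖ + ‖E z‖ := norm_add₃_le
      _ ≤ (k ^ 2 * M) * ‖f z‖ + (ε * ‖z‖ ^ N + k ^ 2 * (C1 + C2') * ‖z‖ ^ (N + 1)) + CE * (2 / R) ^ (N + 1) * ‖z‖ ^ (N + 1) := by
        apply add_le_add (add_le_add (hqf z) _) (hEb (N + 1) z hz)
        rw [norm_mul, hk2]
        exact hD
      _ = _ := by ring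
  have hPs : ∀ (s : ℝ) z, P (s • z) = (s : ℂ) ^ N * P z := by
    intro s z
    simp only [hP, Complex.real_smul, map_mul, Complex.conj_ofReal, mul_pow]; ring
  have hPc : Continuous P := by simp only [hP]; fun_prop
  have hsuppR : ∀ z, f z ≠ 0 → |z.re| ≤ R := by
    intro z hz
    obtain ⟨h2, h3⟩ := hfsupp z hz
    rw [abs_of_nonneg (sector_re h0 h1 h2)]; exact h3
  have r1 := main_gen h0 h1 hfc hcs hRp.le (by positivity) hsuppR N hPc hPs hPb H0 H1 H2
    (E := fun z => Complex.exp (-z)) (by fun_prop) (by intro z; simp [Complex.norm_exp])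
    (by intro s; simpa [Complex.real_smul] using green_exp hfc hcs s)
  have r2 := main_gen h0 h1 hfc hcs hRp.le (by positivity) hsuppR N hPc hPs hPb H0 H1 H2
    (E := fun z => Complex.exp (-conj z)) (by fun_prop) (by intro z; simp [Complex.norm_exp])
    (by intro s; simpa [Complex.real_smul] using green_exp_conj hfc hcs s)
  have hc0 : (k : ℂ) ^ 2 * (1 - q 0) ≠ 0 := by
    apply mul_ne_zero
    · exact pow_ne_zero _ (by exact_mod_cast hk.ne')
    · exact sub_ne_zero.2 (Ne.symm hq0)
  have r1' := (mul_eq_zero.1 r1).resolve_left hc0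
  have r2' := (mul_eq_zero.1 r2).resolve_left hc0
  obtain ⟨ha, hb⟩ := no_annihilate h0 h1 N a b hN r1' r2'
  rcases hab with h | h
  · exact h ha
  · exact h hb

end CornerAux

namespace CornerAux
open Filter Topology

section reduction

lemma second_dir {u : EuclideanSpace ℝ (Fin 2) → ℂ} (hu : ContDiff ℝ 2 u)
    (x a : EuclideanSpace ℝ (Fin 2)) :
    fderiv ℝ (fun y => fderiv ℝ u y a) x a = iteratedFDeriv ℝ 2 u x ![a, a] := by
  rw [iteratedFDeriv_two_apply]
  have hd : DifferentiableAt ℝ (fderiv ℝ u) x :=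
    ((hu.fderiv_right (m := 1) (by norm_num)).differentiable (by norm_num)) x
  rw [fderiv_clm_apply hd (by fun_prop)]
  simp

lemma laplacian2_eq {u : EuclideanSpace ℝ (Fin 2) → ℂ} (hu : ContDiff ℝ 2 u)
    (b : OrthonormalBasis (Fin 2) ℝ (EuclideanSpace ℝ (Fin 2))) (x : EuclideanSpace ℝ (Fin 2)) :
    laplacian2 u x = ∑ i, fderiv ℝ (fun y => fderiv ℝ u y (b i)) x (b i) := by
  unfold laplacian2
  simp_rw [second_dir hu]
  have h1 := congrFun (InnerProductSpace.laplacian_eq_iteratedFDeriv_orthonormalBasis u b) x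
  have h2 := congrFun (InnerProductSpace.laplacian_eq_iteratedFDeriv_orthonormalBasis u
    (EuclideanSpace.basisFun (Fin 2) ℝ)) x
  rw [h1] at h2
  simpa using h2.symm

/-- the linear part of the change of coordinates -/
noncomputable def coordL (e₁ e₂ : EuclideanSpace ℝ (Fin 2)) : ℂ →L[ℝ] EuclideanSpace ℝ (Fin 2) :=
  Complex.reCLM.smulRight e₁ + Complex.imCLM.smulRight e₂

lemma coordL_apply (e₁ e₂ : EuclideanSpace ℝ (Fin 2)) (z : ℂ) :
    coordL e₁ e₂ z = z.re • e₁ + z.im • e₂ := by simp [coordL]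

lemma fderiv_comp_coord {u : EuclideanSpace ℝ (Fin 2) → ℂ} (hu : Differentiable ℝ u)
    (O e₁ e₂ : EuclideanSpace ℝ (Fin 2)) (z w : ℂ) :
    fderiv ℝ (fun z => u (O + coordL e₁ e₂ z)) z w
      = fderiv ℝ u (O + coordL e₁ e₂ z) (coordL e₁ e₂ w) := by
  have h : HasFDerivAt (fun z => O + coordL e₁ e₂ z) (coordL e₁ e₂) z :=
    (coordL e₁ e₂).hasFDerivAt.const_add O
  have := (hu (O + coordL e₁ e₂ z)).hasFDerivAt.comp z h
  have h2 := this.fderiv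
  change fderiv ℝ (u ∘ fun z => O + coordL e₁ e₂ z) z w = _
  rw [h2]; rfl

lemma lapC_coord {u : EuclideanSpace ℝ (Fin 2) → ℂ} (hu : ContDiff ℝ 2 u)
    (O : EuclideanSpace ℝ (Fin 2))
    (b : OrthonormalBasis (Fin 2) ℝ (EuclideanSpace ℝ (Fin 2))) (z : ℂ) :
    lapC (fun z => u (O + coordL (b 0) (b 1) z)) z = laplacian2 u (O + coordL (b 0) (b 1) z) := by
  rw [laplacian2_eq hu b, Fin.sum_univ_two]
  have hd : Differentiable ℝ u := hu.differentiable (by norm_num)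
  have hdd : ∀ a, Differentiable ℝ (fun y => fderiv ℝ u y a) := fun a =>
    (((hu.fderiv_right (m := 1) (by norm_num)).clm_apply contDiff_const).differentiable
      (by norm_num))
  have hX : dX (fun z => u (O + coordL (b 0) (b 1) z))
      = fun z => (fun y => fderiv ℝ u y (b 0)) (O + coordL (b 0) (b 1) z) := by
    funext z; unfold dX; rw [fderiv_comp_coord hd]; simp [coordL_apply]
  have hY : dY (fun z => u (O + coordL (b 0) (b 1) z))
      = fun z => (fun y => fderiv ℝ u y (b 1)) (O + coordL (b 0) (b 1) z) := by
    funext z; unfold dY; rw [fderiv_comp_coord hd]; simp [coordL_apply]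
  unfold lapC
  rw [hX, hY]
  unfold dX dY
  rw [fderiv_comp_coord (hdd (b 0)), fderiv_comp_coord (hdd (b 1))]
  simp [coordL_apply]

end reduction

lemma reduced
    (k : ℝ) (hk : 0 < k)
    (φ₀ : ℝ) (hφ₀ : 0 < φ₀) (hφ₀' : φ₀ < π / 2)
    (O : EuclideanSpace ℝ (Fin 2))
    (b : OrthonormalBasis (Fin 2) ℝ (EuclideanSpace ℝ (Fin 2)))
    (W : Set (EuclideanSpace ℝ (Fin 2)))
    (hW : W = {x | ∃ r : ℝ, 0 ≤ r ∧ ∃ θ : ℝ, |θ| ≤ φ₀ ∧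
      x = O + r • (Real.cos θ • b 0 + Real.sin θ • b 1)})
    (q : EuclideanSpace ℝ (Fin 2) → ℂ)
    (hqbdd : ∃ M : ℝ, ∀ x, ‖q x‖ ≤ M)
    (hqHolder : ∃ r > (0 : ℝ), ∃ α > (0 : ℝ), ∃ C ≥ (0 : ℝ),
      ∀ x ∈ W ∩ ball O r, ∀ y ∈ W ∩ ball O r, ‖q x - q y‖ ≤ C * ‖x - y‖ ^ α)
    (hqO : q O ≠ 1)
    (u uin : EuclideanSpace ℝ (Fin 2) → ℂ)
    (husmooth : ContDiff ℝ 2 u) (huinsmooth : ContDiff ℝ 2 uin)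
    (huinpde : ∀ x, laplacian2 uin x + (k : ℂ) ^ 2 * uin x = 0)
    (hupde : ∀ x, laplacian2 u x + (k : ℂ) ^ 2 * q x * u x = 0)
    (heq : ∀ x, x ∉ W → u x = uin x) :
    ∀ x, uin x = 0 := by
  have hsurj : ∀ x, ∃ z, x = O + coordL (b 0) (b 1) z := by
    intro x
    refine ⟨⟨inner ℝ (b 0) (x - O), inner ℝ (b 1) (x - O)⟩, ?_⟩
    have := b.sum_repr' (x - O)
    rw [Fin.sum_univ_two] at this
    rw [coordL_apply, this]; simp
  have hnorm : ∀ z, ‖coordL (b 0) (b 1) z‖ = ‖z‖ := by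
    intro z
    have h2 : ‖coordL (b 0) (b 1) z‖ ^ 2 = ‖z‖ ^ 2 := by
      have h01 : inner ℝ (b 0) (b 1) = (0 : ℝ) := b.orthonormal.2 (by decide)
      rw [coordL_apply, norm_add_sq_real, norm_smul, norm_smul, real_inner_smul_left,
        real_inner_smul_right, h01, b.norm_eq_one, b.norm_eq_one, Complex.sq_norm,
        Complex.normSq_apply, mul_one, mul_one, Real.norm_eq_abs, Real.norm_eq_abs, sq_abs, sq_abs]
      ring
    exact (sq_eq_sq₀ (norm_nonneg _) (norm_nonneg _)).1 h2
  have hinj : ∀ z w, coordL (b 0) (b 1) z = coordL (b 0) (b 1) w → z = w := by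
    intro z w h
    have := hnorm (z - w)
    rw [map_sub, h, sub_self, norm_zero] at this
    exact sub_eq_zero.1 (norm_eq_zero.1 this.symm)
  have hpol : ∀ r θ : ℝ, r • (Real.cos θ • b 0 + Real.sin θ • b 1)
      = coordL (b 0) (b 1) ⟨r * Real.cos θ, r * Real.sin θ⟩ := by
    intro r θ
    rw [coordL_apply, smul_add, smul_smul, smul_smul]
  have hz0 : (0 : ℂ) ∈ sector φ₀ := by simp [sector]
  have hWin : ∀ z ∈ sector φ₀, O + coordL (b 0) (b 1) z ∈ W := by
    intro z hz
    rw [hW]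
    have hzp : z = ⟨‖z‖ * Real.cos z.arg, ‖z‖ * Real.sin z.arg⟩ := by
      apply Complex.ext
      · simp
      · simp
    rcases eq_or_ne z 0 with h | h
    · refine ⟨0, le_rfl, 0, by simpa using hφ₀.le, by simp [h]⟩
    · refine ⟨‖z‖, norm_nonneg _, z.arg, ?_, ?_⟩
      · rw [hzp] at hz
        exact (mem_polar hφ₀ hφ₀' (norm_pos_iff.2 h) (Complex.abs_arg_le_pi z)).1 hz
      · rw [hpol, ← hzp]
  have hWout : ∀ z, O + coordL (b 0) (b 1) z ∈ W → z ∈ sector φ₀ := by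
    intro z hz
    rw [hW] at hz
    obtain ⟨r, hr, θ, hθ, h⟩ := hz
    rw [hpol] at h
    have := hinj _ _ (add_left_cancel h)
    rcases hr.eq_or_lt with h0 | h0
    · rw [this, ← h0]; simp [sector]
    · rw [this]
      exact (mem_polar hφ₀ hφ₀' h0 (by linarith [Real.pi_pos])).2 hθ
  obtain ⟨M, hM⟩ := hqbdd
  have hsm : ∀ {f : EuclideanSpace ℝ (Fin 2) → ℂ}, ContDiff ℝ 2 f →
      ContDiff ℝ 2 (fun z => f (O + coordL (b 0) (b 1) z)) := fun hf =>
    hf.comp (contDiff_const.add (coordL (b 0) (b 1)).contDiff)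
  have hcore := core k hk hφ₀ hφ₀' (u := fun z => u (O + coordL (b 0) (b 1) z))
    (v := fun z => uin (O + coordL (b 0) (b 1) z)) (q := fun z => q (O + coordL (b 0) (b 1) z))
    (hsm husmooth) (hsm huinsmooth)
    (fun z => by
      rw [lapC_coord huinsmooth]
      linear_combination huinpde (O + coordL (b 0) (b 1) z))
    (fun z => by
      rw [lapC_coord husmooth]
      linear_combination hupde (O + coordL (b 0) (b 1) z))
    (fun z hz => heq _ (fun h => hz (hWout z h))) (fun z => hM _) ?_ (by simpa using hqO)
  · intro x
    obtain ⟨z, rfl⟩ := hsurj x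
    exact hcore z
  · intro ε hε
    obtain ⟨r, hr, α, hα, C, hC, hH⟩ := hqHolder
    have hlim : Tendsto (fun t : ℝ => C * t ^ α) (𝓝 0) (𝓝 0) := by
      have : Tendsto (fun t : ℝ => C * t ^ α) (𝓝 0) (𝓝 (C * 0 ^ α)) :=
        ((Real.continuousAt_rpow_const 0 α (Or.inr hα.le)).tendsto).const_mul C
      simpa [Real.zero_rpow hα.ne'] using this
    have hev := hlim.eventually (gt_mem_nhds hε)
    obtain ⟨δ, hδ, hδ'⟩ := Metric.eventually_nhds_iff.1 hev
    refine ⟨min r δ, lt_min hr hδ, fun z hz hzn => ?_⟩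
    have h1 : O + coordL (b 0) (b 1) z ∈ W ∩ ball O r := by
      refine ⟨hWin z hz, ?_⟩
      rw [mem_ball, dist_eq_norm, add_sub_cancel_left, hnorm]
      exact hzn.trans_le (min_le_left _ _)
    have h2 : O + coordL (b 0) (b 1) 0 ∈ W ∩ ball O r :=
      ⟨hWin 0 hz0, by simpa using hr⟩
    have h3 := hH _ h1 _ h2
    rw [map_zero (coordL (b 0) (b 1)), add_zero, add_sub_cancel_left, hnorm] at h3
    have h4 := @hδ' ‖z‖ (by simpa using hzn.trans_le (min_le_right _ _))
    simp only [map_zero, add_zero]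
    exact h3.trans h4.le

lemma exists_basis {e₁ e₂ : EuclideanSpace ℝ (Fin 2)}
    (he₁ : ‖e₁‖ = 1) (he₂ : ‖e₂‖ = 1) (he : ⟪e₁, e₂⟫_ℝ = 0) :
    ∃ b : OrthonormalBasis (Fin 2) ℝ (EuclideanSpace ℝ (Fin 2)), b 0 = e₁ ∧ b 1 = e₂ := by
  have ho : Orthonormal ℝ ![e₁, e₂] := by
    refine ⟨fun i => by fin_cases i <;> simp [he₁, he₂], fun i j hij => ?_⟩
    fin_cases i <;> fin_cases j <;> simp_all [real_inner_comm]
  have hc : Fintype.card (Fin 2) = Module.finrank ℝ (EuclideanSpace ℝ (Fin 2)) := by simp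
  let B := basisOfOrthonormalOfCardEqFinrank ho hc
  have hB : (B : Fin 2 → _) = ![e₁, e₂] := coe_basisOfOrthonormalOfCardEqFinrank ho hc
  refine ⟨B.toOrthonormalBasis (by rw [hB]; exact ho), ?_, ?_⟩
  · simp [hB]
  · simp [hB]

end CornerAux

/-- Core of Theorem 1.3 (corner scattering in 2D): a convex planar corner with a
contrast that is Hölder continuous near the vertex and jumps there always scatters. -/
theorem corner_scattering_2D
    (k : ℝ) (hk : 0 < k)
    (φ₀ : ℝ) (hφ₀ : 0 < φ₀) (hφ₀' : φ₀ < π / 2)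
    (O : EuclideanSpace ℝ (Fin 2))
    (e₁ e₂ : EuclideanSpace ℝ (Fin 2))
    (he₁ : ‖e₁‖ = 1) (he₂ : ‖e₂‖ = 1) (he₁e₂ : ⟪e₁, e₂⟫_ℝ = 0)
    (W : Set (EuclideanSpace ℝ (Fin 2)))
    (hW : W = {x | ∃ r : ℝ, 0 ≤ r ∧ ∃ θ : ℝ, |θ| ≤ φ₀ ∧
      x = O + r • (Real.cos θ • e₁ + Real.sin θ • e₂)})
    (q : EuclideanSpace ℝ (Fin 2) → ℂ)
    (hqmeas : Measurable q) (hqbdd : ∃ M : ℝ, ∀ x, ‖q x‖ ≤ M)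
    (hqout : ∀ x, x ∉ W → q x = 1)
    (hqsupp : HasCompactSupport (fun x => q x - 1))
    (hqHolder : ∃ r > (0 : ℝ), ∃ α > (0 : ℝ), ∃ C ≥ (0 : ℝ),
      ∀ x ∈ W ∩ ball O r, ∀ y ∈ W ∩ ball O r, ‖q x - q y‖ ≤ C * ‖x - y‖ ^ α)
    (hqO : q O ≠ 1)
    (u uin : EuclideanSpace ℝ (Fin 2) → ℂ)
    (husmooth : ContDiff ℝ 2 u) (huinsmooth : ContDiff ℝ 2 uin)
    (huinpde : ∀ x, laplacian2 uin x + (k : ℂ) ^ 2 * uin x = 0)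
    (hupde : ∀ x, laplacian2 u x + (k : ℂ) ^ 2 * q x * u x = 0)
    (heq : ∀ x, x ∉ W → u x = uin x) :
    ∀ x, uin x = 0 := by
  obtain ⟨b, hb0, hb1⟩ := CornerAux.exists_basis he₁ he₂ he₁e₂
  subst hb0 hb1
  exact CornerAux.reduced k hk φ₀ hφ₀ hφ₀' O b W hW q hqbdd hqHolder hqO u uin
    husmooth huinsmooth huinpde hupde heq
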